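/- Let m_1,…,m_5 be squarefree monomials in the variables x_1,…,x_n forming a minimal generating set, and for a field K let I_K = (m_1,…,m_5) ⊆ K[x_1,…,x_n]. Then pd_{K[x_1,…,x_n]} K[x_1,…,x_n]/I_K is the same for every field K; that is, for a squarefree monomial ideal I with μ(I) = 5, the projective dimension pd_S S/I does not depend on the characteristic of the base field. -/

import Mathlib

/-!
Statement 6 (Lemma `claim:charfree`): for a squarefree monomial ideal `I`
with `μ(I) = 5`, given by a fixed minimal family of five squarefree monomial
generators, the projective dimension `pd_S S/I` is the same over every base
field; i.e. it does not depend on the characteristic of `K`.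
-/

open CategoryTheory MvPolynomial

universe u v

/-- The projective dimension (possibly `⊤`) of a module `M` over a commutative
ring `R`, via the standard characterization by vanishing of `Ext` groups. -/
noncomputable def pdim (R : Type u) [CommRing R] (M : ModuleCat.{u} R) : ℕ∞ :=
  sInf {n : ℕ∞ | ∀ k : ℕ, n < (k : ℕ∞) → ∀ N : ModuleCat.{u} R,
    Subsingleton (((Ext R (ModuleCat.{u} R) k).obj (Opposite.op M)).obj N)}

/-- The squarefree monomial ideal of `K[x_1,…,x_n]` generated by the
monomials with supports `A i`, `i = 1,…,μ`. -/
noncomputable def sqfIdeal (K : Type*) [Field K] {n μ : ℕ}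
    (A : Fin μ → Finset (Fin n)) : Ideal (MvPolynomial (Fin n) K) :=
  Ideal.span (Set.range fun i : Fin μ => ∏ v ∈ A i, (X v : MvPolynomial (Fin n) K))

section MatrixComplex

open Matrix

variable {S : Type u} [CommRing S] {P : Type}

/-- The functions on `P` supported in degree `k`. -/
def degreePart (S : Type u) [CommRing S] {P : Type} (deg : P → ℕ) (k : ℕ) :
    Submodule S (P → S) where
  carrier := {f | ∀ F, deg F ≠ k → f F = 0}
  add_mem' hf hg F hF := by simp [hf F hF, hg F hF]
  zero_mem' F _ := rfl
  smul_mem' c f hf F hF := by simp [hf F hF]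

/-- The projection of all functions on `P` onto those supported in degree `k`. -/
def degreeProj (S : Type u) [CommRing S] {P : Type} (deg : P → ℕ) (k : ℕ) :
    (P → S) →ₗ[S] degreePart S deg k where
  toFun f := ⟨fun F => if deg F = k then f F else 0, fun F hF => by simp [hF]⟩
  map_add' f g := by ext F; by_cases h : deg F = k <;> simp [h]
  map_smul' c f := by ext F; by_cases h : deg F = k <;> simp [h]

theorem degreeProj_apply (deg : P → ℕ) (k : ℕ) (f : P → S) (F : P) :
    (degreeProj S deg k f : P → S) F = if deg F = k then f F else 0 := rfl

theorem degreeProj_coe (deg : P → ℕ) (k : ℕ) (f : degreePart S deg k) :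
    degreeProj S deg k f = f := by
  ext F
  rw [degreeProj_apply]
  split_ifs with h
  · rfl
  · exact (f.2 F h).symm

theorem single_mem_degreePart [DecidableEq P] {deg : P → ℕ} {k : ℕ} {G : P} (hG : deg G = k) :
    (Pi.single G 1 : P → S) ∈ degreePart S deg k := by
  rintro F hF
  rw [Pi.single_eq_of_ne]
  rintro rfl
  exact hF hG

instance [Finite P] (deg : P → ℕ) (k : ℕ) : Module.Projective S (degreePart S deg k) :=
  Module.Projective.of_split (degreePart S deg k).subtype (degreeProj S deg k)
    (LinearMap.ext fun f => degreeProj_coe deg k f)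

variable [Fintype P]

theorem mulVec_mem_degreePart {deg : P → ℕ} {d : Matrix P P S}
    (hd : ∀ H G, deg G ≠ deg H + 1 → d H G = 0) {k : ℕ} {f : P → S}
    (hf : f ∈ degreePart S deg (k + 1)) : d *ᵥ f ∈ degreePart S deg k := by
  intro H hH
  refine Finset.sum_eq_zero fun G _ => ?_
  change d H G * f G = 0
  by_cases hG : deg G = k + 1
  · rw [hd H G (by omega), zero_mul]
  · rw [hf G hG, mul_zero]

theorem mulVec_degreeProj {deg : P → ℕ} {d : Matrix P P S}
    (hd : ∀ H G, deg G ≠ deg H + 1 → d H G = 0) (k : ℕ) (f : P → S) :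
    d *ᵥ (degreeProj S deg (k + 1) f : P → S) = degreeProj S deg k (d *ᵥ f) := by
  ext H
  rw [degreeProj_apply]
  simp only [mulVec, dotProduct, degreeProj_apply]
  split_ifs with hH
  · refine Finset.sum_congr rfl fun G _ => ?_
    by_cases hG : deg G = k + 1
    · simp [hG]
    · rw [hd H G (by omega), zero_mul, zero_mul]
  · refine Finset.sum_eq_zero fun G _ => ?_
    by_cases hG : deg G = k + 1
    · rw [hd H G (by omega), zero_mul]
    · simp [hG]

/-- A homogeneous matrix of degree `-1`, as a map between consecutive degrees. -/
def degreeMap {deg : P → ℕ} {d : Matrix P P S}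
    (hd : ∀ H G, deg G ≠ deg H + 1 → d H G = 0) (k : ℕ) :
    degreePart S deg (k + 1) →ₗ[S] degreePart S deg k :=
  d.mulVecLin.restrict fun _ hf => mulVec_mem_degreePart hd hf

theorem coe_degreeMap {deg : P → ℕ} {d : Matrix P P S}
    (hd : ∀ H G, deg G ≠ deg H + 1 → d H G = 0) (k : ℕ) (f : degreePart S deg (k + 1)) :
    (degreeMap hd k f : P → S) = d *ᵥ (f : P → S) := rfl

/-- The chain complex of free modules given by a homogeneous matrix of degree `-1` and
square zero. -/
noncomputable def matrixComplex {deg : P → ℕ} {d : Matrix P P S}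
    (hd : ∀ H G, deg G ≠ deg H + 1 → d H G = 0) (hdd : d * d = 0) :
    ChainComplex (ModuleCat.{u} S) ℕ :=
  ChainComplex.of (fun k => ModuleCat.of S (degreePart S deg k))
    (fun k => ModuleCat.ofHom (degreeMap hd k)) fun k => by
      ext f : 2
      apply Subtype.ext
      change d *ᵥ (d *ᵥ (f : P → S)) = 0
      rw [mulVec_mulVec, hdd, zero_mulVec]

theorem matrixComplex_d {deg : P → ℕ} {d : Matrix P P S}
    (hd : ∀ H G, deg G ≠ deg H + 1 → d H G = 0) (hdd : d * d = 0) (k : ℕ) :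
    (matrixComplex hd hdd).d (k + 1) k = ModuleCat.ofHom (degreeMap hd k) :=
  ChainComplex.of_d (fun k => ModuleCat.of S (degreePart S deg k))
    (fun k => ModuleCat.ofHom (degreeMap hd k)) k

/-- An exact matrix complex augmented to `M` is a projective resolution of `M`. -/
theorem exists_projectiveResolution_matrixComplex {deg : P → ℕ} {d : Matrix P P S}
    (hd : ∀ H G, deg G ≠ deg H + 1 → d H G = 0) (hdd : d * d = 0)
    (hexact : ∀ k, ∀ f ∈ degreePart S deg (k + 1), d *ᵥ f = 0 → ∃ g, f = d *ᵥ g)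
    (M : ModuleCat.{u} S) (p : degreePart S deg 0 →ₗ[S] M) (hp : Function.Surjective p)
    (hpd : ∀ f : degreePart S deg 0, p f = 0 ↔ ∃ g, (f : P → S) = d *ᵥ g) :
    ∃ R : ProjectiveResolution M, R.complex = matrixComplex hd hdd := by
  have lift : ∀ (k : ℕ) (f : degreePart S deg k), (∃ g, (f : P → S) = d *ᵥ g) →
      ∃ g, degreeMap hd k g = f := by
    rintro k f ⟨g, hg⟩
    refine ⟨degreeProj S deg (k + 1) g, Subtype.ext ?_⟩
    rw [coe_degreeMap, mulVec_degreeProj hd, ← hg, degreeProj_coe]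
  have comp : (matrixComplex hd hdd).d 1 0 ≫ (ModuleCat.ofHom p :
      (matrixComplex hd hdd).X 0 ⟶ M) = 0 := by
    rw [matrixComplex_d]
    ext f : 2
    exact (hpd (degreeMap hd 0 f)).2 ⟨(show degreePart S deg 1 from f).1, rfl⟩
  refine ⟨{ complex := matrixComplex hd hdd
            projective := fun k => ?_
            π := (ChainComplex.toSingle₀Equiv _ _).symm ⟨ModuleCat.ofHom p, comp⟩
            quasiIso := ⟨fun k => ?_⟩ }, rfl⟩
  · exact (IsProjective.iff_projective (degreePart S deg k)).1 inferInstance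
  · cases k with
    | zero =>
      rw [ChainComplex.quasiIsoAt₀_iff, ShortComplex.quasiIso_iff_of_zeros' _ rfl rfl rfl]
      constructor
      · rw [ShortComplex.moduleCat_exact_iff]
        intro x hx
        have hx' : p x = 0 := hx
        obtain ⟨g, hg⟩ := lift 0 x ((hpd x).1 hx')
        refine ⟨g, ?_⟩
        change (matrixComplex hd hdd).d 1 0 g = x
        rw [matrixComplex_d]
        exact hg
      · exact (ModuleCat.epi_iff_surjective (ModuleCat.ofHom p)).2 hp
    | succ k =>
      rw [quasiIsoAt_iff_exactAt' (hL := ChainComplex.exactAt_succ_single_obj ..),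
        HomologicalComplex.exactAt_iff' _ (k + 2) (k + 1) k (by simp) (by simp),
        ShortComplex.moduleCat_exact_iff]
      intro x hx
      change (matrixComplex hd hdd).d (k + 1) k x = 0 at hx
      rw [matrixComplex_d] at hx
      obtain ⟨g, hg⟩ := lift (k + 1) x (hexact k _ (Subtype.prop x) (congrArg Subtype.val hx))
      refine ⟨g, ?_⟩
      change (matrixComplex hd hdd).d (k + 2) (k + 1) g = x
      rw [matrixComplex_d]
      exact hg

theorem linearCombination_mulVec {N : Type*} [AddCommGroup N] [Module S N] (v : P → N)
    (d : Matrix P P S) (f : P → S) :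
    Fintype.linearCombination S v (d *ᵥ f) = ∑ G, f G • ∑ H, d H G • v H := by
  simp only [Fintype.linearCombination_apply, mulVec, dotProduct, Finset.sum_smul,
    Finset.smul_sum]
  rw [Finset.sum_comm]
  exact Finset.sum_congr rfl fun G _ => Finset.sum_congr rfl fun H _ => by
    rw [smul_smul, mul_comm]

theorem map_mulVec_single {N : Type*} [AddCommGroup N] [Module S N] [DecidableEq P]
    (l : (P → S) →ₗ[S] N) (d : Matrix P P S) (G : P) :
    l (d *ᵥ Pi.single G 1) = ∑ H, d H G • l (Pi.single H 1) := by
  conv_lhs => rw [LinearMap.pi_apply_eq_sum_univ l]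
  refine Finset.sum_congr rfl fun H _ => ?_
  rw [mulVec_single_one]
  congr 2
  ext F
  simp [Pi.single_apply, eq_comm]

/-- `Ext` out of a module resolved by a matrix complex, in terms of cochains. -/
theorem subsingleton_ext_iff_of_matrixComplex {deg : P → ℕ} {d : Matrix P P S}
    [DecidableEq P]
    (hd : ∀ H G, deg G ≠ deg H + 1 → d H G = 0) (hdd : d * d = 0)
    {M : ModuleCat.{u} S} (R : ProjectiveResolution M) (hR : R.complex = matrixComplex hd hdd)
    (N : ModuleCat.{u} S) (k : ℕ) :
    Subsingleton (((Ext S (ModuleCat.{u} S) (k + 1)).obj (Opposite.op M)).obj N) ↔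
      ∀ v : P → N, (∀ G, deg G = k + 2 → ∑ H, d H G • v H = 0) →
        ∃ u : P → N, ∀ G, deg G = k + 1 → v G = ∑ H, d H G • u H := by
  rw [← ModuleCat.isZero_iff_subsingleton, (R.isoExt (k + 1) N).isZero_iff, hR,
    ← HomologicalComplex.exactAt_iff_isZero_homology,
    HomologicalComplex.exactAt_iff' _ k (k + 1) (k + 2) (by simp) (by simp),
    ShortComplex.moduleCat_exact_iff]
  have hcycle : ∀ φ : (matrixComplex hd hdd).X (k + 1) ⟶ N,
      ((matrixComplex hd hdd).linearYonedaObj S N).d (k + 1) (k + 2) φ = 0 ↔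
        (φ.hom : degreePart S deg (k + 1) →ₗ[S] N) ∘ₗ degreeMap hd (k + 1) = 0 := by
    intro φ
    change (matrixComplex hd hdd).d (k + 2) (k + 1) ≫ φ = 0 ↔ _
    rw [matrixComplex_d, ModuleCat.hom_ext_iff]
    rfl
  have hbound : ∀ (φ : (matrixComplex hd hdd).X (k + 1) ⟶ N)
      (ψ : (matrixComplex hd hdd).X k ⟶ N),
      ((matrixComplex hd hdd).linearYonedaObj S N).d k (k + 1) ψ = φ ↔
        (ψ.hom : degreePart S deg k →ₗ[S] N) ∘ₗ degreeMap hd k = φ.hom := by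
    intro φ ψ
    change (matrixComplex hd hdd).d (k + 1) k ≫ ψ = φ ↔ _
    rw [matrixComplex_d, ModuleCat.hom_ext_iff]
    rfl
  constructor
  · intro h v hv
    let φ : degreePart S deg (k + 1) →ₗ[S] N :=
      Fintype.linearCombination S v ∘ₗ (degreePart S deg (k + 1)).subtype
    obtain ⟨ψ, hψ⟩ := h (ModuleCat.ofHom φ) <| (hcycle _).2 <| by
      ext f
      change Fintype.linearCombination S v (d *ᵥ (f : P → S)) = 0
      rw [linearCombination_mulVec]
      refine Finset.sum_eq_zero fun G _ => ?_
      by_cases hG : deg G = k + 2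
      · rw [hv G hG, smul_zero]
      · rw [f.2 G hG, zero_smul]
    have hψ' : (ψ.hom : degreePart S deg k →ₗ[S] N) ∘ₗ degreeMap hd k = φ := (hbound _ _).1 hψ
    let l : (P → S) →ₗ[S] N := (ψ.hom : degreePart S deg k →ₗ[S] N) ∘ₗ degreeProj S deg k
    refine ⟨fun F => l (Pi.single F 1), fun G hG => ?_⟩
    have hs := single_mem_degreePart (S := S) hG
    have h1 := map_mulVec_single l d G
    have h2 : l (d *ᵥ Pi.single G 1) = φ ⟨Pi.single G 1, hs⟩ := by
      rw [← hψ']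
      exact congrArg (ψ.hom : degreePart S deg k →ₗ[S] N)
        (degreeProj_coe deg k (degreeMap hd k ⟨Pi.single G 1, hs⟩))
    rw [← h1, h2]
    change v G = Fintype.linearCombination S v (Pi.single G 1)
    rw [Fintype.linearCombination_apply_single, one_smul]
  · intro h φ hφ
    have hφ' := (hcycle φ).1 hφ
    let l : (P → S) →ₗ[S] N := (φ.hom : degreePart S deg (k + 1) →ₗ[S] N) ∘ₗ
      degreeProj S deg (k + 1)
    obtain ⟨u, hu⟩ := h (fun F => l (Pi.single F 1)) fun G hG => by
      have hs := single_mem_degreePart (S := S) hG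
      rw [← map_mulVec_single l d G]
      refine Eq.trans ?_ (LinearMap.congr_fun hφ' ⟨Pi.single G 1, hs⟩)
      exact congrArg (φ.hom : degreePart S deg (k + 1) →ₗ[S] N)
        (degreeProj_coe deg (k + 1) (degreeMap hd (k + 1) ⟨Pi.single G 1, hs⟩))
    refine ⟨ModuleCat.ofHom (Fintype.linearCombination S u ∘ₗ (degreePart S deg k).subtype),
      (hbound _ _).2 ?_⟩
    ext f
    change Fintype.linearCombination S u (d *ᵥ (f : P → S)) = φ.hom f
    have hf : φ.hom f = l f := congrArg φ.hom (degreeProj_coe deg (k + 1) f).symm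
    rw [hf, linearCombination_mulVec]
    conv_rhs => rw [LinearMap.pi_apply_eq_sum_univ l]
    refine Finset.sum_congr rfl fun G _ => ?_
    by_cases hG : deg G = k + 1
    · rw [← hu G hG]
      congr 2
      ext F
      simp [Pi.single_apply, eq_comm]
    · rw [f.2 G hG, zero_smul, zero_smul]

end MatrixComplex

section Boundary

open Matrix Finset

variable {R : Type*} [CommRing R] {r : ℕ}

/-- The sign of `j` relative to `H` in the simplicial boundary. -/
def posSign (R : Type*) [CommRing R] {r : ℕ} (j : Fin r) (H : Finset (Fin r)) : R :=
  (-1) ^ #{i ∈ H | i < j}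

theorem posSign_mul_self (j : Fin r) (H : Finset (Fin r)) :
    posSign R j H * posSign R j H = 1 := by
  rw [posSign, ← pow_add, Even.neg_one_pow ⟨_, rfl⟩]

theorem posSign_insert {i j : Fin r} {H : Finset (Fin r)} (hj : j ∉ H) :
    posSign R i (insert j H) = if j < i then - posSign R i H else posSign R i H := by
  rw [posSign, filter_insert]
  split_ifs with h
  · rw [card_insert_of_notMem (by simp [hj]), pow_succ, posSign]
    ring
  · rfl

theorem posSign_insert_self {j : Fin r} {H : Finset (Fin r)} :
    posSign R j (insert j H) = posSign R j H := by
  simp [posSign, filter_insert]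

theorem posSign_mul_insert_swap {i j : Fin r} {H : Finset (Fin r)} (hij : i ≠ j) (hi : i ∉ H)
    (hj : j ∉ H) :
    posSign R i H * posSign R j (insert i H) = - (posSign R j H * posSign R i (insert j H)) := by
  rw [posSign_insert hi, posSign_insert hj]
  rcases lt_or_gt_of_ne hij with h | h
  · rw [if_pos h, if_neg h.not_gt]; ring
  · rw [if_neg h.not_gt, if_pos h]; ring

theorem posSign_insert_mul_insert {i j : Fin r} {H : Finset (Fin r)} (hij : i ≠ j) (hi : i ∉ H)
    (hj : j ∉ H) :
    posSign R j (insert i H) * posSign R i (insert j H) = - (posSign R i H * posSign R j H) := by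
  rw [posSign_insert hi, posSign_insert hj]
  rcases lt_or_gt_of_ne hij with h | h
  · rw [if_pos h, if_neg h.not_gt]; ring
  · rw [if_neg h.not_gt, if_pos h]; ring

/-- The matrix of the simplicial boundary on `r` vertices with weights `w j H` attached to the
removal of `j` from `insert j H`. -/
def boundary (w : Fin r → Finset (Fin r) → R) : Matrix (Finset (Fin r)) (Finset (Fin r)) R :=
  of fun H G => ∑ j, if j ∉ H ∧ insert j H = G then posSign R j H * w j H else 0

theorem boundary_mulVec (w : Fin r → Finset (Fin r) → R) (f : Finset (Fin r) → R)
    (H : Finset (Fin r)) :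
    (boundary w *ᵥ f) H = ∑ j ∈ Hᶜ, posSign R j H * w j H * f (insert j H) := by
  simp only [mulVec, dotProduct, boundary, of_apply, sum_mul]
  rw [sum_comm, ← sum_filter_add_sum_filter_not univ (fun j => j ∈ Hᶜ), filter_univ_mem]
  rw [add_eq_left.2]
  · refine sum_congr rfl fun j hj => ?_
    rw [mem_compl] at hj
    simp [hj, ite_mul]
  · refine sum_eq_zero fun j hj => sum_eq_zero fun G _ => ?_
    simp at hj
    simp [hj]

theorem boundary_apply_of_card_ne (w : Fin r → Finset (Fin r) → R) (H G : Finset (Fin r))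
    (h : #G ≠ #H + 1) : boundary w H G = 0 := by
  simp only [boundary, of_apply]
  refine sum_eq_zero fun j _ => if_neg ?_
  rintro ⟨hj, rfl⟩
  exact h (card_insert_of_notMem hj)

theorem boundary_mul_self (w : Fin r → Finset (Fin r) → R)
    (hw : ∀ i j H, w i H * w j (insert i H) = w j H * w i (insert j H)) :
    boundary w * boundary w = 0 := by
  refine ext_of_mulVec_single fun G => ?_
  rw [← mulVec_mulVec, zero_mulVec]
  ext H
  simp only [boundary_mulVec, mul_sum, Pi.zero_apply]
  rw [sum_sigma']
  refine sum_involution (fun x _ => ⟨x.2, x.1⟩) ?_ ?_ ?_ ?_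
  · rintro ⟨i, j⟩ hx
    simp only [mem_sigma, mem_compl, mem_insert, not_or] at hx
    have h1 := posSign_mul_insert_swap (R := R) (Ne.symm hx.2.1) hx.1 hx.2.2
    have h2 := hw i j H
    rw [Finset.insert_comm i j]
    generalize (Pi.single G 1 : Finset (Fin r) → R) (insert j (insert i H)) = e
    linear_combination (w i H * w j (insert i H) * e) * h1
      + (- posSign R j H * posSign R i (insert j H) * e) * h2
  · rintro ⟨i, j⟩ hx _ h
    simp only [mem_sigma, mem_compl, mem_insert, not_or] at hx
    exact hx.2.1 (congrArg Sigma.fst h)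
  · rintro ⟨i, j⟩ hx
    simp only [mem_sigma, mem_compl, mem_insert, not_or] at hx ⊢
    exact ⟨hx.2.2, Ne.symm hx.2.1, hx.1⟩
  · rintro ⟨i, j⟩ hx
    rfl

/-- The cone operator with apex `i`. -/
def cone (i : Fin r) (f : Finset (Fin r) → R) (F : Finset (Fin r)) : R :=
  if i ∈ F then posSign R i (F.erase i) * f (F.erase i) else 0

/-- The cone operator is a contracting homotopy of the unweighted boundary. -/
theorem eq_boundary_mulVec_cone (i : Fin r) (f : Finset (Fin r) → R)
    (hf : boundary (fun _ _ => (1 : R)) *ᵥ f = 0) :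
    f = boundary (fun _ _ => (1 : R)) *ᵥ cone i f := by
  ext H
  rw [boundary_mulVec]
  by_cases hi : i ∈ H
  · obtain ⟨H, hi', rfl⟩ : ∃ H', i ∉ H' ∧ H = insert i H' :=
      ⟨H.erase i, notMem_erase i H, (insert_erase hi).symm⟩
    have h := congrFun hf H
    rw [boundary_mulVec, Pi.zero_apply] at h
    have hc : Hᶜ = insert i (insert i H)ᶜ := by
      ext j; by_cases hj : j = i <;> simp [hj, hi']
    rw [hc, sum_insert (by simp)] at h
    have h2 : posSign R i H * f (insert i H) = - ∑ j ∈ (insert i H)ᶜ,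
        posSign R j H * f (insert j H) := by
      simp only [mul_one] at h
      linear_combination h
    have h3 : f (insert i H) = posSign R i H * (posSign R i H * f (insert i H)) := by
      rw [← mul_assoc, posSign_mul_self, one_mul]
    rw [h3, h2, mul_neg, mul_sum, ← sum_neg_distrib]
    refine sum_congr rfl fun j hj => ?_
    simp only [mem_compl, mem_insert, not_or] at hj
    rw [cone, if_pos (by simp), Finset.insert_comm, erase_insert (by simp [hi', Ne.symm hj.1])]
    linear_combination - f (insert j H) * posSign_insert_mul_insert (R := R) (Ne.symm hj.1) hi' hj.2
  · rw [sum_eq_single i]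
    · rw [cone, if_pos (by simp), erase_insert hi, mul_one, ← mul_assoc, posSign_mul_self, one_mul]
    · intro j _ hji
      rw [cone, if_neg (by simp [hi, Ne.symm hji]), mul_zero]
    · simp [hi]

end Boundary

section Taylor

open Matrix Finset

variable {n r : ℕ}

/-- The exponent of the squarefree monomial with support `U`. -/
noncomputable def sqfExp (U : Finset (Fin n)) : Fin n →₀ ℕ := ∑ v ∈ U, Finsupp.single v 1

theorem sqfExp_apply (U : Finset (Fin n)) (v : Fin n) : sqfExp U v = if v ∈ U then 1 else 0 := by
  simp [sqfExp, Finsupp.finsetSum_apply, Finsupp.single_apply]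

theorem sqfExp_le_iff {U : Finset (Fin n)} {b : Fin n →₀ ℕ} :
    sqfExp U ≤ b ↔ ∀ v ∈ U, 1 ≤ b v := by
  rw [Finsupp.le_def]
  refine forall_congr' fun v => ?_
  rw [sqfExp_apply]
  split_ifs with h <;> simp [h]

theorem sqfExp_mono {U V : Finset (Fin n)} (h : U ⊆ V) : sqfExp U ≤ sqfExp V :=
  sum_le_sum_of_subset h

theorem sqfExp_sdiff_union (U V : Finset (Fin n)) :
    sqfExp (U ∪ V) = sqfExp V + sqfExp (U \ V) := by
  rw [sqfExp, sqfExp, sqfExp, ← sum_union disjoint_sdiff, union_sdiff_self_eq_union, union_comm]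

theorem prod_X_eq_monomial (K : Type*) [CommSemiring K] (U : Finset (Fin n)) :
    ∏ v ∈ U, (X v : MvPolynomial (Fin n) K) = monomial (sqfExp U) 1 := by
  rw [sqfExp, monomial_sum_one]
  rfl

theorem mem_sqfIdeal_iff {K : Type*} [Field K] {A : Fin r → Finset (Fin n)}
    {f : MvPolynomial (Fin n) K} :
    f ∈ sqfIdeal K A ↔ ∀ b, (∀ j, ¬ sqfExp (A j) ≤ b) → coeff b f = 0 := by
  have h : (Set.range fun i : Fin r => ∏ v ∈ A i, (X v : MvPolynomial (Fin n) K)) =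
      (fun s => monomial s (1 : K)) '' Set.range fun i => sqfExp (A i) := by
    rw [← Set.range_comp]
    exact congrArg Set.range (funext fun i => prod_X_eq_monomial K (A i))
  rw [sqfIdeal, h, mem_ideal_span_monomial_image]
  refine forall_congr' fun b => ?_
  simp only [mem_support_iff, Set.exists_range_iff]
  constructor
  · intro h1 h2
    by_contra h3
    obtain ⟨j, hj⟩ := h1 h3
    exact h2 j hj
  · intro h1 h2
    by_contra! h3
    exact h2 (h1 h3)

variable (K : Type u) [Field K] (A : Fin r → Finset (Fin n))

/-- The ratio of the least common multiples of the generators in `insert j H` and in `H`. -/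
noncomputable def taylorWeight (j : Fin r) (H : Finset (Fin r)) : MvPolynomial (Fin n) K :=
  ∏ v ∈ A j \ H.biUnion A, X v

/-- The differential of the Taylor resolution. -/
noncomputable def taylor :
    Matrix (Finset (Fin r)) (Finset (Fin r)) (MvPolynomial (Fin n) K) :=
  boundary (taylorWeight K A)

theorem taylor_mul_self : taylor K A * taylor K A = 0 := by
  refine boundary_mul_self _ fun i j H => ?_
  have key : ∀ i j : Fin r, taylorWeight K A i H * taylorWeight K A j (insert i H) =
      ∏ v ∈ (A i ∪ A j) \ H.biUnion A, X v := by
    intro i j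
    rw [taylorWeight, taylorWeight, biUnion_insert, ← prod_union]
    · congr 1
      ext v
      simp only [mem_union, mem_sdiff]
      tauto
    · rw [disjoint_left]
      simp only [mem_union, mem_sdiff]
      tauto
  rw [key, key, union_comm]

theorem taylor_apply_of_card_ne (H G : Finset (Fin r)) (h : #G ≠ #H + 1) :
    taylor K A H G = 0 :=
  boundary_apply_of_card_ne _ H G h

variable {K}

/-- The part of multidegree `b` of a chain of the Taylor resolution. -/
noncomputable def strand (b : Fin n →₀ ℕ) (f : Finset (Fin r) → MvPolynomial (Fin n) K)
    (F : Finset (Fin r)) : K :=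
  if sqfExp (F.biUnion A) ≤ b then coeff (b - sqfExp (F.biUnion A)) (f F) else 0

theorem strand_add (b : Fin n →₀ ℕ) (f : Finset (Fin r) → MvPolynomial (Fin n) K)
    (F : Finset (Fin r)) : strand A (b + sqfExp (F.biUnion A)) f F = coeff b (f F) := by
  rw [strand, if_pos le_add_self, add_tsub_cancel_right]

theorem eq_of_strand_eq {f g : Finset (Fin r) → MvPolynomial (Fin n) K}
    (h : ∀ b, strand A b f = strand A b g) : f = g := by
  ext F b
  rw [← strand_add A, h, strand_add]

theorem strand_taylor_mulVec (b : Fin n →₀ ℕ) (f : Finset (Fin r) → MvPolynomial (Fin n) K) :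
    strand A b (taylor K A *ᵥ f) = boundary (fun _ _ => (1 : K)) *ᵥ strand A b f := by
  ext H
  rw [boundary_mulVec, strand]
  split_ifs with hH
  · rw [taylor, boundary_mulVec, coeff_sum]
    refine sum_congr rfl fun j _ => ?_
    have hs : posSign (MvPolynomial (Fin n) K) j H = C (posSign K j H) := by simp [posSign]
    rw [taylorWeight, prod_X_eq_monomial, hs, mul_assoc, coeff_C_mul, coeff_monomial_mul', one_mul,
      mul_one, strand, biUnion_insert, sqfExp_sdiff_union, tsub_tsub]
    congr 2
    exact propext (le_tsub_iff_left hH)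
  · refine (sum_eq_zero fun j _ => ?_).symm
    rw [strand, if_neg, mul_zero]
    exact fun h => hH ((sqfExp_mono (biUnion_subset_biUnion_of_subset_left _
      (subset_insert j H))).trans h)

theorem finite_strand_ne_zero (f : Finset (Fin r) → MvPolynomial (Fin n) K) :
    {b | strand A b f ≠ 0}.Finite := by
  refine (Set.finite_iUnion fun F : Finset (Fin r) =>
    (f F).support.finite_toSet.image (· + sqfExp (F.biUnion A))).subset fun b hb => ?_
  obtain ⟨F, hF⟩ := Function.ne_iff.1 hb
  rw [Pi.zero_apply, strand, ite_ne_right_iff] at hF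
  exact Set.mem_iUnion.2 ⟨F, _, mem_support_iff.2 hF.2, tsub_add_cancel_of_le hF.1⟩

/-- A finitely supported family of compatible strands comes from a chain. -/
theorem exists_strand_eq (c : (Fin n →₀ ℕ) → Finset (Fin r) → K) (hfin : {b | c b ≠ 0}.Finite)
    (hc : ∀ b F, ¬ sqfExp (F.biUnion A) ≤ b → c b F = 0) :
    ∃ g : Finset (Fin r) → MvPolynomial (Fin n) K, ∀ b, strand A b g = c b := by
  have hfin' : ∀ F : Finset (Fin r), {a | c (a + sqfExp (F.biUnion A)) ≠ 0}.Finite := fun F =>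
    hfin.preimage (add_left_injective _).injOn
  refine ⟨fun F => ∑ a ∈ (hfin' F).toFinset, monomial a (c (a + sqfExp (F.biUnion A)) F),
    fun b => ?_⟩
  ext F
  rw [strand]
  split_ifs with h
  · simp only [coeff_sum, coeff_monomial, sum_ite_eq']
    rw [tsub_add_cancel_of_le h, ite_eq_left_iff]
    intro h'
    simp only [Set.Finite.mem_toFinset, Set.mem_ofPred_eq, not_not,
      tsub_add_cancel_of_le h] at h'
    rw [h', Pi.zero_apply]
  · exact (hc b F h).symm

theorem taylor_exact {f : Finset (Fin r) → MvPolynomial (Fin n) K}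
    (hf : taylor K A *ᵥ f = 0) (hf' : f ∅ ∈ sqfIdeal K A) : ∃ g, f = taylor K A *ᵥ g := by
  classical
  let c : (Fin n →₀ ℕ) → Finset (Fin r) → K := fun b =>
    if h : ∃ j, sqfExp (A j) ≤ b then cone h.choose (strand A b f) else 0
  have hfin : {b | c b ≠ 0}.Finite := by
    refine (finite_strand_ne_zero A f).subset fun b hb h0 => hb ?_
    simp only [c, h0]
    split_ifs
    · ext F
      simp [cone]
    · rfl
  have hc : ∀ b F, ¬ sqfExp (F.biUnion A) ≤ b → c b F = 0 := by
    intro b F hF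
    simp only [c]
    split_ifs with h
    · rw [cone, ite_eq_right_iff]
      intro hm
      rw [strand, if_neg, mul_zero]
      intro hle
      refine hF (sqfExp_le_iff.2 fun v hv => ?_)
      rw [← insert_erase hm, biUnion_insert, mem_union] at hv
      exact hv.elim (sqfExp_le_iff.1 h.choose_spec v) (sqfExp_le_iff.1 hle v)
    · rfl
  obtain ⟨g, hg⟩ := exists_strand_eq A c hfin hc
  refine ⟨g, eq_of_strand_eq A fun b => ?_⟩
  rw [strand_taylor_mulVec, hg]
  by_cases h : ∃ j, sqfExp (A j) ≤ b
  · simp only [c, dif_pos h]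
    refine eq_boundary_mulVec_cone _ _ ?_
    rw [← strand_taylor_mulVec, hf]
    ext F
    simp [strand]
  · simp only [c, dif_neg h, mulVec_zero]
    push Not at h
    ext F
    rw [strand, Pi.zero_apply, ite_eq_right_iff]
    intro hF
    obtain rfl | ⟨j, hj⟩ := F.eq_empty_or_nonempty
    · exact mem_sqfIdeal_iff.1 hf' _ fun j hj => h j (hj.trans tsub_le_self)
    · exact absurd ((sqfExp_mono (subset_biUnion_of_mem A hj)).trans hF) (h j)

theorem exists_projectiveResolution_taylor :
    ∃ R : ProjectiveResolution (ModuleCat.of (MvPolynomial (Fin n) K)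
      (MvPolynomial (Fin n) K ⧸ sqfIdeal K A)),
      R.complex = matrixComplex (taylor_apply_of_card_ne K A) (taylor_mul_self K A) := by
  refine exists_projectiveResolution_matrixComplex _ _ ?_ _
    ((sqfIdeal K A).mkQ ∘ₗ LinearMap.proj ∅ ∘ₗ Submodule.subtype _) ?_ ?_
  · intro k f hf h
    refine taylor_exact A h ?_
    rw [hf ∅ (by simp)]
    exact zero_mem _
  · intro x
    obtain ⟨y, rfl⟩ := Submodule.mkQ_surjective _ x
    exact ⟨⟨Pi.single ∅ y, fun F hF => Pi.single_eq_of_ne (by rintro rfl; simp at hF) _⟩, by simp⟩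
  · intro f
    change Submodule.Quotient.mk ((f : Finset (Fin r) → MvPolynomial (Fin n) K) ∅) = 0 ↔ _
    rw [Submodule.Quotient.mk_eq_zero]
    constructor
    · refine taylor_exact A ?_
      ext1 H
      rw [taylor, boundary_mulVec]
      refine sum_eq_zero fun j _ => ?_
      rw [f.2 _ (by simp), mul_zero]
    · rintro ⟨g, hg⟩
      rw [hg, taylor, boundary_mulVec]
      refine sum_mem fun j _ => Ideal.mul_mem_right _ _ (Ideal.mul_mem_left _ _ ?_)
      rw [taylorWeight, biUnion_empty, sdiff_empty]
      exact Ideal.subset_span ⟨j, rfl⟩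

theorem subsingleton_ext_sqfIdeal_iff (N : ModuleCat.{u} (MvPolynomial (Fin n) K)) (k : ℕ) :
    Subsingleton (((Ext (MvPolynomial (Fin n) K) (ModuleCat.{u} (MvPolynomial (Fin n) K))
      (k + 1)).obj (Opposite.op (ModuleCat.of (MvPolynomial (Fin n) K)
        (MvPolynomial (Fin n) K ⧸ sqfIdeal K A)))).obj N) ↔
      ∀ v : Finset (Fin r) → N, (∀ G, #G = k + 2 → ∑ H, taylor K A H G • v H = 0) →
        ∃ u : Finset (Fin r) → N, ∀ G, #G = k + 1 → v G = ∑ H, taylor K A H G • u H := by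
  obtain ⟨R, hR⟩ := exists_projectiveResolution_taylor (K := K) A
  exact subsingleton_ext_iff_of_matrixComplex _ _ R hR N k

end Taylor

section Reduction

open Matrix Finset

theorem Matrix.exists_mul_mul_self_eq {K ι κ : Type*} [Field K] [Fintype ι] [Fintype κ]
    (M : Matrix ι κ K) : ∃ N : Matrix κ ι K, M * N * M = M := by
  classical
  obtain ⟨g, hg⟩ := (toLin' M).rangeRestrict.exists_rightInverse_of_surjective
    (LinearMap.range_rangeRestrict _)
  obtain ⟨h, hh⟩ := LinearMap.exists_extend g
  refine ⟨LinearMap.toMatrix' h, toLin'.injective (LinearMap.ext fun x => ?_)⟩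
  have h1 := LinearMap.congr_fun hh ((toLin' M).rangeRestrict x)
  have h2 := congrArg Subtype.val (LinearMap.congr_fun hg ((toLin' M).rangeRestrict x))
  simp only [LinearMap.comp_apply, Submodule.subtype_apply, LinearMap.codRestrict_apply,
    LinearMap.id_apply, LinearMap.rangeRestrict] at h1 h2
  simp only [toLin'_mul, toLin'_toMatrix', LinearMap.comp_apply, h1, h2]

variable {n r : ℕ}

/-- Exactness in degree `k` of the cochain complex with differential `v ↦ v ᵥ* d`. -/
def VecMulExactAt {K : Type*} [CommRing K] (d : Matrix (Finset (Fin r)) (Finset (Fin r)) K)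
    (k : ℕ) : Prop :=
  ∀ v : Finset (Fin r) → K, (∀ G, #G = k + 1 → (v ᵥ* d) G = 0) →
    ∃ u : Finset (Fin r) → K, ∀ G, #G = k → v G = (u ᵥ* d) G

theorem VecMulExactAt.exists_homotopy {K : Type*} [Field K]
    {d : Matrix (Finset (Fin r)) (Finset (Fin r)) K} {k : ℕ}
    (h : VecMulExactAt d k) :
    ∃ a b : Matrix (Finset (Fin r)) (Finset (Fin r)) K, ∀ F G, #F = k → #G = k →
      (a * d + d * b) F G = (1 : Matrix _ _ K) F G := by
  let p : Matrix (Finset (Fin r)) (Finset (Fin r)) K := diagonal fun F => if #F = k then 1 else 0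
  obtain ⟨b, hb⟩ := (p * d).exists_mul_mul_self_eq
  have key : ∀ F, ∃ u : Finset (Fin r) → K, ∀ G, #G = k →
      (1 - p * d * b) F G = (u ᵥ* d) G := by
    intro F
    have hv : ∀ G, #G = k + 1 → (((1 - p * d * b) * p) F ᵥ* d) G = 0 := by
      intro G _
      rw [← mul_apply_eq_vecMul, Matrix.mul_assoc, sub_mul, hb, one_mul, sub_self]
      rfl
    obtain ⟨u, hu⟩ := h _ hv
    refine ⟨u, fun G hG => ?_⟩
    rw [← hu G hG, mul_diagonal, if_pos hG, mul_one]
  choose a ha using key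
  refine ⟨of a, b, fun F G hF hG => ?_⟩
  have h1 : (of a * d) F G = (a F ᵥ* d) G := rfl
  rw [Matrix.add_apply, h1, ← ha F G hG, Matrix.sub_apply, Matrix.mul_assoc, diagonal_mul,
    if_pos hF, one_mul, sub_add_cancel]

variable (K : Type u) [Field K] (A : Fin r → Finset (Fin n))

/-- The differential of the Taylor resolution modulo the variables. -/
def reducedTaylor (K : Type*) [CommRing K] (A : Fin r → Finset (Fin n)) :
    Matrix (Finset (Fin r)) (Finset (Fin r)) K :=
  boundary fun j H => if A j ⊆ H.biUnion A then 1 else 0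

theorem card_biUnion_insert_eq_iff {j : Fin r} {H : Finset (Fin r)} :
    #(H.biUnion A) = #((insert j H).biUnion A) ↔ A j ⊆ H.biUnion A := by
  rw [biUnion_insert]
  constructor
  · intro h
    rw [eq_of_subset_of_card_le (subset_union_right (s₁ := A j)) h.ge]
    exact subset_union_left
  · intro h
    rw [union_eq_right.2 h]

theorem reducedTaylor_apply_of_card_biUnion_ne {K : Type*} [CommRing K] {H G : Finset (Fin r)}
    (h : #(H.biUnion A) ≠ #(G.biUnion A)) : reducedTaylor K A H G = 0 := by
  simp only [reducedTaylor, boundary, of_apply]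
  refine sum_eq_zero fun j _ => ?_
  rw [ite_eq_right_iff]
  rintro ⟨_, rfl⟩
  rw [if_neg fun h' => h ((card_biUnion_insert_eq_iff A).2 h'), mul_zero]

theorem taylor_apply_of_card_biUnion_lt {H G : Finset (Fin r)}
    (h : #(G.biUnion A) < #(H.biUnion A)) : taylor K A H G = 0 := by
  simp only [taylor, boundary, of_apply]
  refine sum_eq_zero fun j _ => if_neg ?_
  rintro ⟨_, rfl⟩
  exact h.not_ge (card_le_card (biUnion_subset_biUnion_of_subset_left _ (subset_insert j H)))

theorem taylor_apply_of_card_biUnion_eq {H G : Finset (Fin r)}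
    (h : #(H.biUnion A) = #(G.biUnion A)) : taylor K A H G = C (reducedTaylor K A H G) := by
  simp only [taylor, reducedTaylor, boundary, of_apply, map_sum]
  refine sum_congr rfl fun j _ => ?_
  split_ifs with hj hA
  · rw [taylorWeight, sdiff_eq_empty_iff_subset.2 hA]
    simp [posSign]
  · obtain ⟨_, rfl⟩ := hj
    exact absurd ((card_biUnion_insert_eq_iff A).1 h) hA
  · simp

theorem constantCoeff_taylor (H G : Finset (Fin r)) :
    constantCoeff (taylor K A H G) = reducedTaylor K A H G := by
  simp only [taylor, reducedTaylor, boundary, of_apply, map_sum]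
  refine sum_congr rfl fun j _ => ?_
  split_ifs with hj hA
  · rw [taylorWeight, sdiff_eq_empty_iff_subset.2 hA]
    simp [posSign]
  · obtain ⟨x, hx⟩ := sdiff_nonempty.2 hA
    rw [mul_zero, map_mul, taylorWeight, map_prod, prod_eq_zero hx (constantCoeff_X K x), mul_zero]
  · simp

theorem reducedTaylor_apply_of_card_ne {K : Type*} [CommRing K] (H G : Finset (Fin r))
    (h : #G ≠ #H + 1) : reducedTaylor K A H G = 0 :=
  boundary_apply_of_card_ne _ H G h

theorem reducedTaylor_mul_self : reducedTaylor K A * reducedTaylor K A = 0 := by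
  have h : reducedTaylor K A = (taylor K A).map constantCoeff := by
    ext H G
    exact (constantCoeff_taylor K A H G).symm
  rw [h, ← Matrix.map_mul, taylor_mul_self, Matrix.map_zero _ (map_zero _)]

variable {K A}

theorem exists_eq_sum_taylor_smul {k : ℕ} (h : VecMulExactAt (reducedTaylor K A) k)
    {N : Type*} [AddCommGroup N] [Module (MvPolynomial (Fin n) K) N] (v : Finset (Fin r) → N)
    (hv : ∀ G, #G = k + 1 → ∑ H, taylor K A H G • v H = 0) :
    ∃ u : Finset (Fin r) → N, ∀ G, #G = k → v G = ∑ H, taylor K A H G • u H := by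
  obtain ⟨a, b, hab⟩ := h.exists_homotopy
  suffices H : ∀ s w : ℕ, n + 1 ≤ w + s → ∀ v : Finset (Fin r) → N,
      (∀ G, #G = k + 1 → ∑ H, taylor K A H G • v H = 0) →
      (∀ G, #G = k → #(G.biUnion A) < w → v G = 0) →
      ∃ u : Finset (Fin r) → N, ∀ G, #G = k → v G = ∑ H, taylor K A H G • u H from
    H (n + 1) 0 (by simp) v hv fun G _ h => absurd h (Nat.not_lt_zero _)
  clear v hv
  intro s
  induction s with
  | zero =>
    intro w hw v _ hv'
    refine ⟨0, fun G hG => ?_⟩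
    rw [hv' G hG, eq_comm]
    · simp
    · have := card_le_univ (G.biUnion A)
      rw [Fintype.card_fin] at this
      omega
  | succ s ih =>
    intro w hw v hv hv'
    let vw : Finset (Fin r) → N := fun F => if #F = k ∧ #(F.biUnion A) = w then v F else 0
    have hvw : ∀ H, ∑ F, (C (reducedTaylor K A F H) : MvPolynomial (Fin n) K) • vw F = 0 := by
      intro H
      by_cases hH : #H = k + 1 ∧ #(H.biUnion A) = w
      · rw [← hv H hH.1]
        refine sum_congr rfl fun F _ => ?_
        by_cases hF : #F = k
        · rcases lt_trichotomy #(F.biUnion A) w with hlt | heq | hgt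
          · rw [hv' F hF hlt, reducedTaylor_apply_of_card_biUnion_ne A (by omega)]
            simp
          · rw [taylor_apply_of_card_biUnion_eq K A (by omega)]
            simp only [vw]
            rw [if_pos ⟨hF, heq⟩]
          · rw [taylor_apply_of_card_biUnion_lt K A (by omega),
              reducedTaylor_apply_of_card_biUnion_ne A (by omega)]
            simp
        · rw [taylor_apply_of_card_ne K A F H (by omega),
            reducedTaylor_apply_of_card_ne A F H (by omega)]
          simp
      · refine sum_eq_zero fun F _ => ?_
        simp only [vw]
        split_ifs with hF
        · by_cases h1 : #H = k + 1
          · rw [reducedTaylor_apply_of_card_biUnion_ne A (by omega)]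
            simp
          · rw [reducedTaylor_apply_of_card_ne A F H (by omega)]
            simp
        · rw [smul_zero]
    let u : Finset (Fin r) → N := fun H =>
      if #(H.biUnion A) = w then ∑ F, (C (a F H) : MvPolynomial (Fin n) K) • vw F else 0
    have hu : ∀ G, #G = k → #(G.biUnion A) = w → ∑ H, taylor K A H G • u H = v G := by
      intro G hG hGw
      calc ∑ H, taylor K A H G • u H
          = ∑ H, (C (reducedTaylor K A H G) : MvPolynomial (Fin n) K) •
              ∑ F, (C (a F H) : MvPolynomial (Fin n) K) • vw F := by
            refine sum_congr rfl fun H _ => ?_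
            simp only [u]
            split_ifs with hH
            · rw [taylor_apply_of_card_biUnion_eq K A (by omega)]
            · rw [reducedTaylor_apply_of_card_biUnion_ne A (by omega)]
              simp
        _ = ∑ F, (C ((a * reducedTaylor K A) F G) : MvPolynomial (Fin n) K) • vw F := by
            simp only [smul_sum, smul_smul, ← C_mul, mul_apply, map_sum, sum_smul]
            rw [sum_comm]
            simp only [mul_comm]
        _ = ∑ F, (C ((a * reducedTaylor K A + reducedTaylor K A * b) F G) :
              MvPolynomial (Fin n) K) • vw F := by
            simp only [Matrix.add_apply, C_add, add_smul, sum_add_distrib]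
            rw [eq_comm, add_eq_left]
            simp only [mul_apply, map_sum, sum_smul]
            rw [sum_comm]
            refine sum_eq_zero fun H _ => ?_
            simp only [mul_comm _ (b H G), C_mul, mul_smul]
            rw [← smul_sum, hvw, smul_zero]
        _ = vw G := by
            rw [sum_eq_single G]
            · rw [hab G G hG hG, one_apply_eq, C_1, one_smul]
            · intro F _ hF
              by_cases hFk : #F = k
              · rw [hab F G hFk hG, one_apply_ne hF, C_0, zero_smul]
              · simp [vw, hFk]
            · simp
        _ = v G := if_pos ⟨hG, hGw⟩
    have hw1 : ∀ G, #G = k + 1 →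
        ∑ H, taylor K A H G • (v H - ∑ F, taylor K A F H • u F) = 0 := by
      intro G hG
      simp only [smul_sub, sum_sub_distrib]
      rw [hv G hG, zero_sub, neg_eq_zero]
      simp only [smul_sum, smul_smul]
      rw [sum_comm]
      refine sum_eq_zero fun H _ => ?_
      have h1 := congrFun (congrFun (taylor_mul_self K A) H) G
      rw [mul_apply, Matrix.zero_apply] at h1
      simp only [mul_comm (taylor K A _ G)]
      rw [← sum_smul, h1, zero_smul]
    have hw2 : ∀ G, #G = k → #(G.biUnion A) < w + 1 →
        v G - ∑ H, taylor K A H G • u H = 0 := by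
      intro G hG hGw
      rcases Nat.lt_succ_iff_lt_or_eq.1 hGw with hlt | heq
      · rw [hv' G hG hlt, zero_sub, neg_eq_zero]
        refine sum_eq_zero fun H _ => ?_
        simp only [u]
        split_ifs with hH
        · rw [taylor_apply_of_card_biUnion_lt K A (by omega), zero_smul]
        · rw [smul_zero]
      · rw [hu G hG heq, sub_self]
    obtain ⟨u', hu'⟩ := ih (w + 1) (by omega) _ hw1 hw2
    refine ⟨u + u', fun G hG => ?_⟩
    simp only [Pi.add_apply, smul_add, sum_add_distrib]
    rw [← hu' G hG, add_sub_cancel]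

theorem forall_subsingleton_ext_sqfIdeal_iff (k : ℕ) :
    (∀ N : ModuleCat.{u} (MvPolynomial (Fin n) K),
      Subsingleton (((Ext (MvPolynomial (Fin n) K) (ModuleCat.{u} (MvPolynomial (Fin n) K))
        (k + 1)).obj (Opposite.op (ModuleCat.of (MvPolynomial (Fin n) K)
          (MvPolynomial (Fin n) K ⧸ sqfIdeal K A)))).obj N)) ↔
      VecMulExactAt (reducedTaylor K A) (k + 1) := by
  simp only [subsingleton_ext_sqfIdeal_iff]
  constructor
  · intro h v hv
    let : Module (MvPolynomial (Fin n) K) K := Module.compHom K constantCoeff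
    have hs : ∀ (p : MvPolynomial (Fin n) K) (x : K), p • x = x * constantCoeff p :=
      fun p x => mul_comm _ _
    have key := h (ModuleCat.of (MvPolynomial (Fin n) K) K) v
    simp only [hs, constantCoeff_taylor] at key
    exact key hv
  · intro h N v hv
    exact exists_eq_sum_taylor_smul h v hv

end Reduction

section Constraints

/-- The functions that agree on pairs related by `R` and vanish on `B`. -/
def constrainedFunctions (K : Type*) [Field K] {α : Type*} (R : α → α → Prop) (B : α → Prop) :
    Submodule K (α → K) where
  carrier := {g | (∀ x y, R x y → g x = g y) ∧ ∀ x, B x → g x = 0}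
  add_mem' := by
    rintro g h ⟨hg, hg'⟩ ⟨hh, hh'⟩
    exact ⟨fun x y hxy => congrArg₂ (· + ·) (hg x y hxy) (hh x y hxy),
      fun x hx => by rw [Pi.add_apply, hg' x hx, hh' x hx, add_zero]⟩
  zero_mem' := ⟨fun _ _ _ => rfl, fun _ _ => rfl⟩
  smul_mem' := by
    rintro c g ⟨hg, hg'⟩
    exact ⟨fun x y hxy => congrArg (c • ·) (hg x y hxy),
      fun x hx => by rw [Pi.smul_apply, hg' x hx, smul_zero]⟩

theorem finrank_constrainedFunctions (K : Type*) [Field K] {α : Type*} [Finite α]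
    (R : α → α → Prop) (B : α → Prop) :
    Module.finrank K (constrainedFunctions K R B) =
      Nat.card {q : Quot R // ∀ x, B x → Quot.mk R x ≠ q} := by
  classical
  have : Fintype {q : Quot R // ∀ x, B x → Quot.mk R x ≠ q} := Fintype.ofFinite _
  rw [Nat.card_eq_fintype_card, ← Module.finrank_fintype_fun_eq_card K]
  refine LinearEquiv.finrank_eq
    { toFun := fun g q => Quot.lift g.1 g.2.1 q.1
      invFun := fun h => ⟨fun x => if hx : ∀ y, B y → Quot.mk R y ≠ Quot.mk R x then
        h ⟨Quot.mk R x, hx⟩ else 0, fun x y hxy => by simp only [Quot.sound hxy],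
        fun x hx => dif_neg fun h => h x hx rfl⟩
      map_add' := ?_
      map_smul' := ?_
      left_inv := ?_
      right_inv := ?_ }
  · rintro g h
    ext ⟨⟨x⟩, hx⟩
    rfl
  · rintro c g
    ext ⟨⟨x⟩, hx⟩
    rfl
  · rintro ⟨g, hg, hg'⟩
    ext x
    simp only
    split_ifs with h
    · rfl
    · push Not at h
      obtain ⟨y, hy, hyx⟩ := h
      exact (hg' y hy).symm.trans (congrArg (Quot.lift g hg) hyx)
  · intro h
    ext ⟨⟨x⟩, hx⟩
    exact dif_pos hx

end Constraints

section Rank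

open Matrix Finset

theorem Matrix.rank_add_finrank_ker_vecMulLinear {K ι κ : Type*} [Field K] [Fintype ι]
    [Fintype κ] (M : Matrix ι κ K) :
    M.rank + Module.finrank K (LinearMap.ker M.vecMulLinear) = Fintype.card ι := by
  have h := LinearMap.finrank_range_add_finrank_ker M.vecMulLinear
  rwa [← mulVecLin_transpose, Module.finrank_fintype_fun_eq_card, ← Matrix.rank,
    rank_transpose, mulVecLin_transpose] at h

theorem Matrix.rank_add_finrank_ker_mulVecLin {K ι κ : Type*} [Field K] [Fintype κ]
    (M : Matrix ι κ K) :
    M.rank + Module.finrank K (LinearMap.ker M.mulVecLin) = Fintype.card κ := by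
  have h := LinearMap.finrank_range_add_finrank_ker M.mulVecLin
  rwa [Module.finrank_fintype_fun_eq_card] at h

theorem Matrix.forall_exists_eq_vecMul_iff_rank {K ι κ τ : Type*} [Field K] [Fintype ι]
    [Fintype κ] [Fintype τ] (M : Matrix ι κ K) (N : Matrix κ τ K) (h : M * N = 0) :
    (∀ v, v ᵥ* N = 0 → ∃ u, v = u ᵥ* M) ↔ M.rank + N.rank = Fintype.card κ := by
  have hle : LinearMap.range M.vecMulLinear ≤ LinearMap.ker N.vecMulLinear := by
    rintro _ ⟨u, rfl⟩
    rw [LinearMap.mem_ker, vecMulLinear_apply, vecMulLinear_apply, vecMul_vecMul, h, vecMul_zero]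
  have hM : Module.finrank K (LinearMap.range M.vecMulLinear) = M.rank := by
    rw [← mulVecLin_transpose, ← Matrix.rank, rank_transpose]
  have hN := N.rank_add_finrank_ker_vecMulLinear
  have hiff : (∀ v, v ᵥ* N = 0 → ∃ u, v = u ᵥ* M) ↔
      LinearMap.ker N.vecMulLinear ≤ LinearMap.range M.vecMulLinear := by
    refine forall₂_congr fun v _ => exists_congr fun u => eq_comm
  rw [hiff]
  constructor
  · intro h'
    rw [← hM, le_antisymm hle h']
    omega
  · intro h'
    exact (Submodule.eq_of_le_of_finrank_eq hle (by omega)).ge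

variable {r : ℕ}

/-- The block of a matrix from the `k`-subsets to the `(k + 1)`-subsets. -/
def cardBlock {K : Type*} (d : Matrix (Finset (Fin r)) (Finset (Fin r)) K) (k : ℕ) :
    Matrix {F : Finset (Fin r) // #F = k} {G : Finset (Fin r) // #G = k + 1} K :=
  d.submatrix Subtype.val Subtype.val

theorem sum_subtype_card {K : Type*} [AddCommMonoid K] {k : ℕ} {f : Finset (Fin r) → K}
    (hf : ∀ F, #F ≠ k → f F = 0) : ∑ F : {F : Finset (Fin r) // #F = k}, f F = ∑ F, f F := by
  rw [← sum_subtype (univ.filter fun F => #F = k) (by simp) f, sum_filter_of_ne]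
  exact fun F _ h => by_contra fun h' => h (hf F h')

theorem exists_eq_restrict_card {K : Type*} [Zero K] {k : ℕ}
    (v : {F : Finset (Fin r) // #F = k} → K) :
    ∃ v' : Finset (Fin r) → K, v = fun F => v' F.1 :=
  ⟨fun F => if h : #F = k then v ⟨F, h⟩ else 0, funext fun F => by simp [F.2]⟩

theorem vecMul_cardBlock {K : Type*} [CommRing K]
    {d : Matrix (Finset (Fin r)) (Finset (Fin r)) K} (hd : ∀ H G, #G ≠ #H + 1 → d H G = 0)
    {k : ℕ} (v : Finset (Fin r) → K) (G : {G : Finset (Fin r) // #G = k + 1}) :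
    ((fun F => v F.1) ᵥ* cardBlock d k) G = (v ᵥ* d) G.1 := by
  simp only [vecMul, dotProduct, cardBlock, submatrix_apply]
  refine sum_subtype_card (f := fun F => v F * d F G.1) fun F hF => ?_
  rw [hd F G.1 (by omega), mul_zero]

theorem cardBlock_mul_cardBlock {K : Type*} [CommRing K]
    {d : Matrix (Finset (Fin r)) (Finset (Fin r)) K} (hd : ∀ H G, #G ≠ #H + 1 → d H G = 0)
    (hdd : d * d = 0) (k : ℕ) : cardBlock d k * cardBlock d (k + 1) = 0 := by
  ext F G
  rw [mul_apply]
  refine (sum_subtype_card (f := fun H => d F.1 H * d H G.1) fun H hH => ?_).trans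
    (congrFun (congrFun hdd F.1) G.1)
  rw [hd F.1 H (by omega), zero_mul]

theorem vecMulExactAt_succ_iff {K : Type*} [Field K]
    {d : Matrix (Finset (Fin r)) (Finset (Fin r)) K} (hd : ∀ H G, #G ≠ #H + 1 → d H G = 0)
    (hdd : d * d = 0) (k : ℕ) :
    VecMulExactAt d (k + 1) ↔ (cardBlock d k).rank + (cardBlock d (k + 1)).rank =
      Fintype.card {F : Finset (Fin r) // #F = k + 1} := by
  rw [← forall_exists_eq_vecMul_iff_rank _ _ (cardBlock_mul_cardBlock hd hdd k)]
  constructor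
  · intro h v hv
    obtain ⟨v, rfl⟩ := exists_eq_restrict_card v
    obtain ⟨u, hu⟩ := h v fun G hG => by
      rw [← vecMul_cardBlock hd v ⟨G, hG⟩, hv, Pi.zero_apply]
    exact ⟨fun F => u F.1, funext fun G => by rw [vecMul_cardBlock hd u G, hu G.1 G.2]⟩
  · intro h v hv
    obtain ⟨u, hu⟩ := h (fun F => v F.1) (funext fun G => by
      rw [vecMul_cardBlock hd v G, hv G.1 G.2, Pi.zero_apply])
    obtain ⟨u, rfl⟩ := exists_eq_restrict_card u
    exact ⟨u, fun G hG => by rw [← vecMul_cardBlock hd u ⟨G, hG⟩, ← hu]⟩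

end Rank

section CharFree

open Matrix Finset

variable {n r : ℕ}

theorem mulVec_cardBlock {K : Type*} [CommRing K]
    {d : Matrix (Finset (Fin r)) (Finset (Fin r)) K} (hd : ∀ H G, #G ≠ #H + 1 → d H G = 0)
    {k : ℕ} (g : Finset (Fin r) → K) (F : {F : Finset (Fin r) // #F = k}) :
    (cardBlock d k *ᵥ fun G => g G.1) F = (d *ᵥ g) F.1 := by
  simp only [mulVec, dotProduct, cardBlock, submatrix_apply]
  refine sum_subtype_card (f := fun G => d F.1 G * g G) fun G hG => ?_
  rw [hd F.1 G (by omega), zero_mul]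

theorem reducedTaylor_apply_ne_zero_iff {K : Type*} [Field K] (A : Fin r → Finset (Fin n))
    {H G : Finset (Fin r)} :
    reducedTaylor K A H G ≠ 0 ↔ ∃ j ∉ H, insert j H = G ∧ A j ⊆ H.biUnion A := by
  simp only [reducedTaylor, boundary, of_apply]
  constructor
  · intro h
    obtain ⟨j, -, hj⟩ := exists_ne_zero_of_sum_ne_zero h
    simp only [ne_eq, ite_eq_right_iff, Classical.not_imp, mul_ite, mul_one, mul_zero] at hj
    exact ⟨j, hj.1.1, hj.1.2, hj.2.1⟩
  · rintro ⟨j, hj, rfl, hA⟩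
    rw [sum_eq_single j]
    · rw [if_pos ⟨hj, rfl⟩, if_pos hA, mul_one, posSign]
      exact pow_ne_zero _ (neg_ne_zero.2 one_ne_zero)
    · rintro i - hij
      refine if_neg fun h => ?_
      have := h.2 ▸ mem_insert_self i H
      exact (mem_insert.1 this).elim hij h.1
    · simp

theorem ker_mulVecLin_cardBlock_of_subsingleton (K : Type*) [Field K]
    (A : Fin r → Finset (Fin n)) {k : ℕ} [Subsingleton {G : Finset (Fin r) // #G = k + 1}] :
    LinearMap.ker (cardBlock (reducedTaylor K A) k).mulVecLin =
      constrainedFunctions K (fun _ _ => False)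
        fun G => ∃ H : {H : Finset (Fin r) // #H = k}, ∃ j ∉ H.1, insert j H.1 = G.1 ∧
          A j ⊆ H.1.biUnion A := by
  ext g
  simp only [← reducedTaylor_apply_ne_zero_iff (K := K)]
  rw [LinearMap.mem_ker, mulVecLin_apply]
  constructor
  · refine fun h => ⟨fun _ _ => False.elim, ?_⟩
    rintro G ⟨H, hH⟩
    have h1 : ∑ G, cardBlock (reducedTaylor K A) k H G * g G = 0 := congrFun h H
    rw [Fintype.sum_subsingleton (fun G => cardBlock (reducedTaylor K A) k H G * g G) G] at h1
    exact (mul_eq_zero.1 h1).resolve_left hH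
  · intro h
    ext H
    rw [mulVec, dotProduct, Pi.zero_apply]
    refine sum_eq_zero fun G _ => ?_
    by_cases hH : reducedTaylor K A H.1 G.1 = 0
    · exact mul_eq_zero_of_left hH _
    · exact mul_eq_zero_of_right _ (h.2 G ⟨H, hH⟩)

theorem rank_cardBlock_eq_of_ker_mulVecLin_eq {K : Type u} {K' : Type v} [Field K] [Field K']
    {k : ℕ} {d : Matrix (Finset (Fin r)) (Finset (Fin r)) K}
    {d' : Matrix (Finset (Fin r)) (Finset (Fin r)) K'}
    (h : Module.finrank K (LinearMap.ker (cardBlock d k).mulVecLin) =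
      Module.finrank K' (LinearMap.ker (cardBlock d' k).mulVecLin)) :
    (cardBlock d k).rank = (cardBlock d' k).rank := by
  have h1 := (cardBlock d k).rank_add_finrank_ker_mulVecLin
  have h2 := (cardBlock d' k).rank_add_finrank_ker_mulVecLin
  omega

theorem rank_cardBlock_eq_of_ker_vecMulLinear_eq {K : Type u} {K' : Type v} [Field K] [Field K']
    {k : ℕ} {d : Matrix (Finset (Fin r)) (Finset (Fin r)) K}
    {d' : Matrix (Finset (Fin r)) (Finset (Fin r)) K'}
    (h : Module.finrank K (LinearMap.ker (cardBlock d k).vecMulLinear) =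
      Module.finrank K' (LinearMap.ker (cardBlock d' k).vecMulLinear)) :
    (cardBlock d k).rank = (cardBlock d' k).rank := by
  have h1 := (cardBlock d k).rank_add_finrank_ker_vecMulLinear
  have h2 := (cardBlock d' k).rank_add_finrank_ker_vecMulLinear
  omega

/-- The product of the signs of the vertices missing from `G`. -/
def complSign (K : Type*) [CommRing K] (G : Finset (Fin r)) : K :=
  ∏ j ∈ Gᶜ, posSign K j univ

theorem complSign_mul_mul_self (K : Type*) [CommRing K] (G : Finset (Fin r)) (x : K) :
    complSign K G * (complSign K G * x) = x := by
  rw [← mul_assoc, complSign, ← prod_mul_distrib, prod_eq_one fun j _ => posSign_mul_self j _,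
    one_mul]

theorem complSign_compl_singleton (K : Type*) [CommRing K] (j : Fin r) :
    complSign K ({j}ᶜ : Finset (Fin r)) = posSign K j univ := by
  rw [complSign, compl_compl, prod_singleton]

/-- The relations between the codimension one entries of a cycle of codimension one. -/
theorem boundary_mulVec_eq_zero_iff_of_compl_eq_pair {K : Type*} [CommRing K]
    (w : Fin r → Finset (Fin r) → K) (g : Finset (Fin r) → K) {i j : Fin r} (hij : i < j) :
    (boundary w *ᵥ g) ({i, j}ᶜ) = 0 ↔
      w i ({i, j}ᶜ) * (complSign K {j}ᶜ * g {j}ᶜ) = w j ({i, j}ᶜ) * (complSign K {i}ᶜ * g {i}ᶜ) := by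
  have hi : i ∉ ({i, j}ᶜ : Finset (Fin r)) := by simp
  have hj : j ∉ ({i, j}ᶜ : Finset (Fin r)) := by simp
  have hi' : insert i ({i, j}ᶜ : Finset (Fin r)) = {j}ᶜ := by
    ext x; by_cases hx : x = i <;> simp [hx, hij.ne]
  have hj' : insert j ({i, j}ᶜ : Finset (Fin r)) = {i}ᶜ := by
    ext x; by_cases hx : x = j <;> simp [hx, hij.ne']
  have hsi : posSign K i univ = posSign K i {i, j}ᶜ := by
    rw [← union_compl {i}, ← insert_eq, posSign_insert_self, ← hj', posSign_insert hj,
      if_neg hij.not_gt]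
  have hsj : posSign K j univ = - posSign K j {i, j}ᶜ := by
    rw [← union_compl {j}, ← insert_eq, posSign_insert_self, ← hi', posSign_insert hi, if_pos hij]
  rw [boundary_mulVec, compl_compl, sum_pair hij.ne, hi', hj', complSign_compl_singleton,
    complSign_compl_singleton, hsi, hsj]
  have h1 := posSign_mul_self (R := K) i {i, j}ᶜ
  have h2 := posSign_mul_self (R := K) j {i, j}ᶜ
  generalize posSign K i {i, j}ᶜ = s at *
  generalize posSign K j {i, j}ᶜ = t at *
  constructor
  · intro h
    linear_combination - s * t * h + w i {i, j}ᶜ * g {j}ᶜ * t * h1 + w j {i, j}ᶜ * g {i}ᶜ * s * h2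
  · intro h
    linear_combination - s * t * h - w i {i, j}ᶜ * g {j}ᶜ * s * h2 - w j {i, j}ᶜ * g {i}ᶜ * t * h1

theorem finrank_ker_mulVecLin_cardBlock {k : ℕ} (K : Type*) [Field K]
    (A : Fin (k + 2) → Finset (Fin n)) :
    Module.finrank K (LinearMap.ker (cardBlock (reducedTaylor K A) k).mulVecLin) =
      Module.finrank K (constrainedFunctions K
        (fun G G' : {G : Finset (Fin (k + 2)) // #G = k + 1} => ∃ i j, i ≠ j ∧
          G.1 = {j}ᶜ ∧ G'.1 = {i}ᶜ ∧ A i ⊆ ({i, j}ᶜ : Finset _).biUnion A ∧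
            A j ⊆ ({i, j}ᶜ : Finset _).biUnion A)
        fun G => ∃ i j, i ≠ j ∧ G.1 = {j}ᶜ ∧ A i ⊆ ({i, j}ᶜ : Finset _).biUnion A ∧
            ¬ A j ⊆ ({i, j}ᶜ : Finset _).biUnion A) := by
  let e : ({G : Finset (Fin (k + 2)) // #G = k + 1} → K) ≃ₗ[K]
      ({G : Finset (Fin (k + 2)) // #G = k + 1} → K) :=
    { toFun := fun g G => complSign K G.1 * g G
      invFun := fun g G => complSign K G.1 * g G
      map_add' := fun g h => funext fun G => mul_add _ _ _
      map_smul' := fun c g => funext fun G => mul_left_comm _ _ _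
      left_inv := fun g => funext fun G => complSign_mul_mul_self _ _ _
      right_inv := fun g => funext fun G => complSign_mul_mul_self _ _ _ }
  rw [← LinearEquiv.finrank_map_eq e, Submodule.map_equiv_eq_comap_symm]
  refine congrArg (fun p : Submodule K _ => Module.finrank K p) ?_
  ext g
  obtain ⟨g, rfl⟩ := exists_eq_restrict_card g
  have he : e.symm (fun G => g G.1) = fun G => complSign K G.1 * g G.1 := rfl
  rw [Submodule.mem_comap, LinearEquiv.coe_coe, LinearMap.mem_ker, mulVecLin_apply, he]
  have hcard : ∀ j : Fin (k + 2), #({j}ᶜ : Finset (Fin (k + 2))) = k + 1 := fun j => by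
    rw [card_compl, card_singleton, Fintype.card_fin, Nat.add_succ_sub_one]
  have key : (cardBlock (reducedTaylor K A) k *ᵥ fun G => complSign K G.1 * g G.1) = 0 ↔
      ∀ i j : Fin (k + 2), i ≠ j →
        (if A i ⊆ ({i, j}ᶜ : Finset _).biUnion A then (1 : K) else 0) * g {j}ᶜ =
          (if A j ⊆ ({i, j}ᶜ : Finset _).biUnion A then (1 : K) else 0) * g {i}ᶜ := by
    have hpair : ∀ i j : Fin (k + 2), i < j →
        ((reducedTaylor K A *ᵥ fun G => complSign K G * g G) {i, j}ᶜ = 0 ↔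
        (if A i ⊆ ({i, j}ᶜ : Finset _).biUnion A then (1 : K) else 0) * g {j}ᶜ =
          (if A j ⊆ ({i, j}ᶜ : Finset _).biUnion A then (1 : K) else 0) * g {i}ᶜ) := by
      intro i j hij
      rw [reducedTaylor, boundary_mulVec_eq_zero_iff_of_compl_eq_pair _ _ hij,
        complSign_mul_mul_self, complSign_mul_mul_self]
    constructor
    · intro h
      have h' : ∀ i j : Fin (k + 2), i < j → _ := fun i j hij => (hpair i j hij).1 <| by
        have hc : #({i, j}ᶜ : Finset (Fin (k + 2))) = k := by
          rw [card_compl, card_pair hij.ne, Fintype.card_fin, Nat.add_sub_cancel]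
        have := congrFun h ⟨_, hc⟩
        rwa [mulVec_cardBlock (reducedTaylor_apply_of_card_ne A)
          (fun G => complSign K G * g G)] at this
      intro i j hij
      rcases lt_or_gt_of_ne hij with hlt | hgt
      · exact h' i j hlt
      · rw [Finset.pair_comm i j]
        exact (h' j i hgt).symm
    · intro h
      ext ⟨F, hF⟩
      rw [mulVec_cardBlock (reducedTaylor_apply_of_card_ne A) (fun G => complSign K G * g G),
        Pi.zero_apply]
      obtain ⟨i, j, hij, hFc⟩ := card_eq_two.1 (show #Fᶜ = 2 by
        rw [card_compl, hF, Fintype.card_fin, Nat.add_sub_cancel_left])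
      wlog hlt : i < j generalizing i j
      · exact this j i hij.symm (hFc.trans (Finset.pair_comm i j)) (by omega)
      rw [compl_eq_comm] at hFc
      simp only [← hFc]
      exact (hpair i j hlt).2 (h i j hij)
  rw [key]
  constructor
  · refine fun h => ⟨?_, ?_⟩
    · rintro ⟨_, h1⟩ ⟨_, h2⟩ ⟨i, j, hij, rfl, rfl, hi, hj⟩
      have := h i j hij
      rwa [if_pos hi, if_pos hj, one_mul, one_mul] at this
    · rintro ⟨_, h1⟩ ⟨i, j, hij, rfl, hi, hj⟩
      have := h i j hij
      rwa [if_pos hi, if_neg hj, one_mul, zero_mul] at this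
  · rintro ⟨h1, h2⟩ i j hij
    split_ifs with hi hj hj
    · have hg : g {j}ᶜ = g {i}ᶜ :=
        h1 ⟨_, hcard j⟩ ⟨_, hcard i⟩ ⟨i, j, hij, rfl, rfl, hi, hj⟩
      rw [hg]
    · have hg : g {j}ᶜ = 0 := h2 ⟨_, hcard j⟩ ⟨i, j, hij, rfl, hi, hj⟩
      rw [hg, mul_zero, zero_mul]
    · have hg : g {i}ᶜ = 0 := h2 ⟨_, hcard i⟩ ⟨j, i, hij.symm, rfl,
        Finset.pair_comm i j ▸ hj, Finset.pair_comm i j ▸ hi⟩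
      rw [hg, mul_zero, zero_mul]
    · simp

end CharFree

section Pairs

open Matrix Finset

variable {n r : ℕ}

theorem vecMul_boundary {K : Type*} [CommRing K] (w : Fin r → Finset (Fin r) → K)
    (f : Finset (Fin r) → K) (G : Finset (Fin r)) :
    (f ᵥ* boundary w) G =
      ∑ j ∈ G, f (G.erase j) * (posSign K j (G.erase j) * w j (G.erase j)) := by
  simp only [vecMul, dotProduct, boundary, of_apply, mul_sum]
  rw [sum_comm, ← sum_subset (subset_univ G)]
  · refine sum_congr rfl fun j hj => ?_
    rw [sum_eq_single (G.erase j)]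
    · rw [if_pos ⟨notMem_erase j G, insert_erase hj⟩]
    · rintro H - hH
      rw [if_neg, mul_zero]
      rintro ⟨hjH, rfl⟩
      exact hH (erase_insert hjH).symm
    · simp
  · rintro j - hj
    refine sum_eq_zero fun H _ => ?_
    rw [if_neg, mul_zero]
    rintro ⟨-, rfl⟩
    exact hj (mem_insert_self j H)

theorem vecMul_reducedTaylor_triple {K : Type*} [CommRing K] (A : Fin r → Finset (Fin n))
    (f : Finset (Fin r) → K) {i j k : Fin r} (hij : i < j) (hjk : j < k) :
    (f ᵥ* reducedTaylor K A) {i, j, k} = (if A k ⊆ A i ∪ A j then f {i, j} else 0) +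
      (if A i ⊆ A j ∪ A k then f {j, k} else 0) - (if A j ⊆ A k ∪ A i then f {i, k} else 0) := by
  have hik := hij.trans hjk
  have h1 : ({i, j, k} : Finset (Fin r)).erase i = {j, k} := by
    ext x; by_cases hx : x = i <;> simp [hx, hij.ne, hik.ne]
  have h2 : ({i, j, k} : Finset (Fin r)).erase j = {i, k} := by
    ext x; by_cases hx : x = j <;> simp [hx, hij.ne', hjk.ne]
  have h3 : ({i, j, k} : Finset (Fin r)).erase k = {i, j} := by
    ext x; by_cases hx : x = k <;> simp [hx, hik.ne', hjk.ne']
  have s1 : posSign K i {j, k} = 1 := by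
    simp [posSign, filter_insert, filter_singleton, hij.not_gt, hik.not_gt]
  have s2 : posSign K j {i, k} = -1 := by
    simp [posSign, filter_insert, filter_singleton, hij, hjk.not_gt]
  have s3 : posSign K k {i, j} = 1 := by
    simp [posSign, filter_insert, filter_singleton, hik, hjk, card_pair hij.ne]
  rw [reducedTaylor, vecMul_boundary, sum_insert (by simp [hij.ne, hik.ne]), sum_pair hjk.ne,
    h1, h2, h3, s1, s2, s3]
  simp only [biUnion_insert, singleton_biUnion, mul_ite, mul_one, mul_zero]
  rw [union_comm (A k)]
  split_ifs <;> ring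

/-- The alternating function of two arguments given by the values of `f` at the pairs. -/
def alternate {K : Type*} [CommRing K] (f : Finset (Fin r) → K) (i j : Fin r) : K :=
  if i < j then f {i, j} else if j < i then - f {i, j} else 0

theorem alternate_self {K : Type*} [CommRing K] (f : Finset (Fin r) → K) (i : Fin r) :
    alternate f i i = 0 := by
  simp [alternate]

theorem alternate_swap {K : Type*} [CommRing K] (f : Finset (Fin r) → K) (i j : Fin r) :
    alternate f j i = - alternate f i j := by
  rw [alternate, alternate, Finset.pair_comm]
  split_ifs with h1 h2 <;> first | omega | simp

/-- The cocycle condition on the triple `i`, `j`, `k`. -/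
def tripleSum {K : Type*} [CommRing K] (A : Fin r → Finset (Fin n)) (F : Fin r → Fin r → K)
    (i j k : Fin r) : K :=
  (if A k ⊆ A i ∪ A j then F i j else 0) + (if A i ⊆ A j ∪ A k then F j k else 0) +
    (if A j ⊆ A k ∪ A i then F k i else 0)

theorem tripleSum_rotate {K : Type*} [CommRing K] (A : Fin r → Finset (Fin n))
    (F : Fin r → Fin r → K) (i j k : Fin r) : tripleSum A F j k i = tripleSum A F i j k := by
  rw [tripleSum, tripleSum]
  ring

theorem tripleSum_swap {K : Type*} [CommRing K] (A : Fin r → Finset (Fin n))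
    {F : Fin r → Fin r → K} (hF : ∀ i j, F j i = - F i j) (i j k : Fin r) :
    tripleSum A F j i k = - tripleSum A F i j k := by
  rw [tripleSum, tripleSum, hF i j, hF k i, hF j k, union_comm (A j) (A i),
    union_comm (A i) (A k), union_comm (A k) (A j)]
  split_ifs <;> ring

theorem tripleSum_self {K : Type*} [CommRing K] (A : Fin r → Finset (Fin n))
    {F : Fin r → Fin r → K} (hF : ∀ i j, F j i = - F i j) (hF' : ∀ i, F i i = 0) (i k : Fin r) :
    tripleSum A F i i k = 0 := by
  rw [tripleSum, hF', hF i k]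
  simp

theorem tripleSum_eq_zero {K : Type*} [CommRing K] (A : Fin r → Finset (Fin n))
    {F : Fin r → Fin r → K} (hF : ∀ i j, F j i = - F i j) (hF' : ∀ i, F i i = 0)
    (h : ∀ i j k, i < j → j < k → tripleSum A F i j k = 0) (i j k : Fin r) :
    tripleSum A F i j k = 0 := by
  have hlt : ∀ i j k, i < j → tripleSum A F i j k = 0 := by
    intro i j k hij
    rcases lt_trichotomy j k with hjk | rfl | hkj
    · exact h i j k hij hjk
    · rw [← tripleSum_rotate, tripleSum_self A hF hF']
    · rcases lt_trichotomy i k with hik | rfl | hki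
      · rw [← tripleSum_rotate, ← tripleSum_rotate, tripleSum_swap A hF, h i k j hik hkj, neg_zero]
      · rw [← tripleSum_rotate, ← tripleSum_rotate, tripleSum_self A hF hF']
      · rw [← tripleSum_rotate, ← tripleSum_rotate, h k i j hki hij]
  rcases lt_trichotomy i j with hij | rfl | hji
  · exact hlt i j k hij
  · exact tripleSum_self A hF hF' i k
  · rw [tripleSum_swap A hF, hlt j i k hji, neg_zero]

theorem tripleSum_alternate {K : Type*} [CommRing K] (A : Fin r → Finset (Fin n))
    (f : Finset (Fin r) → K) {i j k : Fin r} (hij : i < j) (hjk : j < k) :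
    tripleSum A (alternate f) i j k = (f ᵥ* reducedTaylor K A) {i, j, k} := by
  rw [vecMul_reducedTaylor_triple A f hij hjk, tripleSum, alternate, alternate, alternate,
    if_pos hij, if_pos hjk, if_neg (hij.trans hjk).not_gt, if_pos (hij.trans hjk),
    Finset.pair_comm k i]
  split_ifs <;> ring

theorem vecMul_cardBlock_two_eq_zero_iff {K : Type*} [Field K] (A : Fin r → Finset (Fin n))
    (f : Finset (Fin r) → K) :
    (fun F => f F.1) ᵥ* cardBlock (reducedTaylor K A) 2 = 0 ↔
      ∀ i j k, tripleSum A (alternate f) i j k = 0 := by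
  constructor
  · refine fun h => tripleSum_eq_zero A (fun i j => alternate_swap f i j) (alternate_self f)
      fun i j k hij hjk => ?_
    have hc : #({i, j, k} : Finset (Fin r)) = 2 + 1 :=
      card_eq_three.2 ⟨i, j, k, hij.ne, (hij.trans hjk).ne, hjk.ne, rfl⟩
    rw [tripleSum_alternate A f hij hjk,
      ← vecMul_cardBlock (reducedTaylor_apply_of_card_ne A) f ⟨_, hc⟩, h, Pi.zero_apply]
  · intro h
    ext ⟨G, hG⟩
    rw [vecMul_cardBlock (reducedTaylor_apply_of_card_ne A) f, Pi.zero_apply]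
    obtain ⟨i, j, k, hij, hjk, rfl⟩ : ∃ i j k, i < j ∧ j < k ∧ G = {i, j, k} := by
      refine ⟨G.orderEmbOfFin hG 0, G.orderEmbOfFin hG 1, G.orderEmbOfFin hG 2,
        (G.orderEmbOfFin hG).lt_iff_lt.2 (by decide),
        (G.orderEmbOfFin hG).lt_iff_lt.2 (by decide), ?_⟩
      refine (image_orderEmbOfFin_univ G hG).symm.trans ?_
      simp [Fin.univ_succ]
    rw [← tripleSum_alternate A f hij hjk, h]

/-- The pairs with prescribed least common multiple are encoded by functions of a support `U` and a
vertex of the graph on the generators dividing `U` in which `i` and `j` are joined when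
`A i ∪ A j ≠ U`. Such a function is normalized to vanish at the base point `m U`. -/
def componentFunctions (K : Type*) [Field K] (A : Fin r → Finset (Fin n))
    (m : Finset (Fin n) → Fin r) : Submodule K (Finset (Fin n) × Fin r → K) :=
  constrainedFunctions K
    (fun x y => x.1 = y.1 ∧ A x.2 ⊆ x.1 ∧ A y.2 ⊆ x.1 ∧ A x.2 ∪ A y.2 ≠ x.1)
    fun x => A x.2 ⊆ x.1 → x.2 = m x.1

variable {K : Type*} [Field K] {A : Fin r → Finset (Fin n)} {m : Finset (Fin n) → Fin r}

theorem mem_componentFunctions_of_tripleSum {F : Fin r → Fin r → K}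
    (hF : ∀ i j, F j i = - F i j) (hF' : ∀ i, F i i = 0) (h : ∀ i j k, tripleSum A F i j k = 0) :
    (fun x : Finset (Fin n) × Fin r => if A (m x.1) ∪ A x.2 = x.1 then F (m x.1) x.2 else 0) ∈
      componentFunctions K A m := by
  refine ⟨?_, ?_⟩
  · rintro ⟨U, i⟩ ⟨_, j⟩ ⟨rfl, hi, hj, hij⟩
    dsimp only at hi hj hij ⊢
    have hk := h (m U) i j
    have hne : ∀ a, A (m U) ∪ a = U → a ⊆ A i ∪ A j → ¬ A (m U) ⊆ A i ∪ A j :=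
      fun a hU ha hmU => hij ((union_subset hi hj).antisymm (hU ▸ union_subset hmU ha))
    rw [tripleSum, union_comm (A j)] at hk
    split_ifs with hUi hUj hUj
    · rw [hUi, hUj, if_pos hi, if_pos hj, if_neg (hne _ hUi subset_union_left), hF (m U) j] at hk
      linear_combination hk
    · rw [hUi, if_pos hj, if_neg (hne _ hUi subset_union_left), if_neg, add_zero, add_zero] at hk
      · exact hk
      · refine fun h' => hUj ((union_subset (subset_union_left.trans hUi.subset) hj).antisymm ?_)
        exact hUi.symm.subset.trans (union_subset subset_union_left h')
    · rw [hUj, if_pos hi, if_neg (hne _ hUj subset_union_right), if_neg, zero_add, zero_add,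
        hF (m U) j] at hk
      · linear_combination hk
      · refine fun h' => hUi ((union_subset (subset_union_left.trans hUj.subset) hi).antisymm ?_)
        exact hUj.symm.subset.trans (union_subset subset_union_left h')
    · rfl
  · rintro ⟨U, i⟩ hi
    dsimp only at hi ⊢
    split_ifs with hU
    · rw [← hi (hU ▸ subset_union_right), hF']
    · rfl

theorem eq_zero_of_tripleSum (hm : ∀ U i, A i ⊆ U → A (m U) ⊆ U) {F : Fin r → Fin r → K}
    (hF : ∀ i j, F j i = - F i j) (h : ∀ i j k, tripleSum A F i j k = 0)
    (h0 : ∀ U i, A (m U) ∪ A i = U → F (m U) i = 0) (i j : Fin r) : F i j = 0 := by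
  have hU := hm (A i ∪ A j) i subset_union_left
  have hk := h i j (m (A i ∪ A j))
  have h1 : A j ⊆ A (m (A i ∪ A j)) ∪ A i → F (m (A i ∪ A j)) i = 0 := fun h' => h0 _ _ <|
    (union_subset hU subset_union_left).antisymm (union_subset subset_union_right h')
  have h2 : A i ⊆ A j ∪ A (m (A i ∪ A j)) → F j (m (A i ∪ A j)) = 0 := fun h' => by
    rw [hF, h0, neg_zero]
    exact (union_subset hU subset_union_right).antisymm
      (union_subset (union_comm (A j) _ ▸ h') subset_union_right)
  rw [tripleSum, if_pos hU, ite_eq_right_iff.2 h1, ite_eq_right_iff.2 h2, add_zero, add_zero] at hk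
  exact hk

theorem tripleSum_of_mem_componentFunctions {g : Finset (Fin n) × Fin r → K}
    (hg : g ∈ componentFunctions K A m) (i j k : Fin r) :
    tripleSum A (fun i j => g (A i ∪ A j, j) - g (A i ∪ A j, i)) i j k = 0 := by
  have key : ∀ i j k, A k ⊆ A i ∪ A j →
      tripleSum A (fun i j => g (A i ∪ A j, j) - g (A i ∪ A j, i)) i j k = 0 := by
    intro i j k hk
    have hside : ∀ a b c, A c ⊆ A a ∪ A b →
        (if A a ⊆ A b ∪ A c then g (A b ∪ A c, c) - g (A b ∪ A c, b) else 0) =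
          g (A a ∪ A b, c) - g (A a ∪ A b, b) := by
      intro a b c hc
      split_ifs with ha
      · rw [show A b ∪ A c = A a ∪ A b from
          (union_subset subset_union_right hc).antisymm (union_subset ha subset_union_left)]
      · rw [eq_comm, sub_eq_zero]
        refine hg.1 _ _ ⟨rfl, hc, subset_union_right, fun h => ha ?_⟩
        rw [union_comm (A b), h]
        exact subset_union_left
    have h2 := hside j i k (union_comm (A i) (A j) ▸ hk)
    rw [tripleSum, if_pos hk, hside i j k hk]
    rw [union_comm (A j) (A i)] at h2
    rw [union_comm (A k) (A i)]
    split_ifs at h2 ⊢ <;> linear_combination -h2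
  by_cases hk : A k ⊆ A i ∪ A j
  · exact key i j k hk
  by_cases hi : A i ⊆ A j ∪ A k
  · rw [← tripleSum_rotate, key j k i hi]
  by_cases hj : A j ⊆ A k ∪ A i
  · rw [← tripleSum_rotate, ← tripleSum_rotate, key k i j hj]
  · rw [tripleSum, if_neg hk, if_neg hi, if_neg hj, add_zero, add_zero]

theorem eq_zero_of_mem_componentFunctions (hm : ∀ U i, A i ⊆ U → A (m U) ⊆ U)
    {g : Finset (Fin n) × Fin r → K} (hg : g ∈ componentFunctions K A m)
    (h0 : ∀ i j, g (A i ∪ A j, j) - g (A i ∪ A j, i) = 0) : g = 0 := by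
  ext ⟨U, i⟩
  rw [Pi.zero_apply]
  by_cases hi : A i ⊆ U
  · have hbase : g (U, m U) = 0 := hg.2 _ fun _ => rfl
    rw [← hbase]
    by_cases hU : A (m U) ∪ A i = U
    · have := h0 (m U) i
      rwa [hU, sub_eq_zero] at this
    · exact (hg.1 (U, m U) (U, i) ⟨rfl, hm U i hi, hi, hU⟩).symm
  · exact hg.2 _ fun h => absurd h hi

theorem finrank_le_of_forall_mem {V W : Type*} [AddCommGroup V] [Module K V] [AddCommGroup W]
    [Module K W] [FiniteDimensional K W] (f : V →ₗ[K] W) {p : Submodule K V} {q : Submodule K W}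
    (h : ∀ x ∈ p, f x ∈ q) (h0 : ∀ x ∈ p, f x = 0 → x = 0) :
    Module.finrank K p ≤ Module.finrank K q := by
  refine LinearMap.finrank_le_finrank_of_injective (f := f.restrict h) ?_
  rw [← LinearMap.ker_eq_bot, LinearMap.ker_eq_bot']
  exact fun x hx => Subtype.ext (h0 x.1 x.2 (congrArg Subtype.val hx))

theorem finrank_ker_vecMulLinear_cardBlock_two (hm : ∀ U i, A i ⊆ U → A (m U) ⊆ U) :
    Module.finrank K (LinearMap.ker (cardBlock (reducedTaylor K A) 2).vecMulLinear) =
      Module.finrank K (componentFunctions K A m) := by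
  let E : ({F : Finset (Fin r) // #F = 2} → K) →ₗ[K] Finset (Fin r) → K :=
    { toFun := fun v F => if h : #F = 2 then v ⟨F, h⟩ else 0
      map_add' := fun v w => by ext F; by_cases h : #F = 2 <;> simp [h]
      map_smul' := fun c v => by ext F; by_cases h : #F = 2 <;> simp [h] }
  have hE : ∀ v, (fun F : {F : Finset (Fin r) // #F = 2} => E v F.1) = v :=
    fun v => funext fun F => dif_pos F.2
  let alt : (Finset (Fin r) → K) →ₗ[K] Fin r → Fin r → K :=
    { toFun := alternate
      map_add' := fun f g => by
        ext i j
        simp only [alternate, Pi.add_apply]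
        split_ifs <;> ring
      map_smul' := fun c f => by
        ext i j
        simp only [alternate, Pi.smul_apply, smul_eq_mul, RingHom.id_apply]
        split_ifs <;> ring }
  let toComponents : (Fin r → Fin r → K) →ₗ[K] Finset (Fin n) × Fin r → K :=
    { toFun := fun F x => if A (m x.1) ∪ A x.2 = x.1 then F (m x.1) x.2 else 0
      map_add' := fun F G => by
        ext x
        simp only [Pi.add_apply]
        split_ifs <;> ring
      map_smul' := fun c F => by
        ext x
        simp only [Pi.smul_apply, smul_eq_mul, RingHom.id_apply]
        split_ifs <;> ring }
  let ofComponents : (Finset (Fin n) × Fin r → K) →ₗ[K] Finset (Fin r) → K :=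
    { toFun := fun g F => - ∑ i ∈ F, posSign K i F * g (F.biUnion A, i)
      map_add' := fun g h => by
        ext F
        simp only [Pi.add_apply, mul_add, sum_add_distrib, neg_add]
      map_smul' := fun c g => by
        ext F
        simp only [Pi.smul_apply, smul_eq_mul, RingHom.id_apply, mul_neg, mul_sum, mul_left_comm] }
  have hof : ∀ g, alternate (ofComponents g) = fun i j => g (A i ∪ A j, j) - g (A i ∪ A j, i) := by
    have hlt : ∀ g i j, i < j → ofComponents g {i, j} = g (A i ∪ A j, j) - g (A i ∪ A j, i) := by
      intro g i j hij
      change - ∑ l ∈ ({i, j} : Finset (Fin r)), posSign K l {i, j} * g (_, l) = _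
      rw [sum_pair hij.ne]
      simp [posSign, filter_insert, filter_singleton, hij, hij.not_gt]
      ring
    intro g
    ext i j
    rw [alternate]
    split_ifs with h1 h2
    · exact hlt g i j h1
    · rw [Finset.pair_comm, hlt g j i h2, union_comm, neg_sub]
    · rw [show i = j by omega, sub_self]
  refine le_antisymm
    (finrank_le_of_forall_mem (toComponents ∘ₗ alt ∘ₗ E) (fun v hv => ?_) fun v hv h0 => ?_)
    (finrank_le_of_forall_mem (LinearMap.funLeft K K Subtype.val ∘ₗ ofComponents)
      (fun g hg => ?_) fun g hg h0 => ?_)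
  · rw [LinearMap.mem_ker, vecMulLinear_apply, ← hE v, vecMul_cardBlock_two_eq_zero_iff] at hv
    exact mem_componentFunctions_of_tripleSum (alternate_swap (E v)) (alternate_self (E v)) hv
  · rw [LinearMap.mem_ker, vecMulLinear_apply, ← hE v, vecMul_cardBlock_two_eq_zero_iff] at hv
    have hz := eq_zero_of_tripleSum hm (alternate_swap (E v)) hv fun U i hU => by
      have : (if A (m U) ∪ A i = U then alternate (E v) (m U) i else 0) = 0 :=
        congrFun h0 (U, i)
      rwa [if_pos hU] at this
    ext ⟨F, hF⟩
    obtain ⟨i, j, hij, rfl⟩ := card_eq_two.1 hF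
    wlog hlt : i < j generalizing i j
    · have := this j i hij.symm (card_pair hij.symm) (by omega)
      exact (congrArg v (Subtype.ext (Finset.pair_comm i j))).trans this
    have := hz i j
    rw [alternate, if_pos hlt] at this
    rwa [← hE v]
  · rw [LinearMap.mem_ker, vecMulLinear_apply]
    refine (vecMul_cardBlock_two_eq_zero_iff A (ofComponents g)).2 ?_
    rw [hof]
    exact tripleSum_of_mem_componentFunctions hg
  · refine eq_zero_of_mem_componentFunctions hm hg fun i j => ?_
    rw [← congrFun (congrFun (hof g) i) j, alternate]
    have hF : ∀ i j, i ≠ j → ofComponents g {i, j} = 0 := fun i j hij =>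
      congrFun h0 ⟨{i, j}, card_pair hij⟩
    split_ifs with h1 h2
    · exact hF i j h1.ne
    · rw [hF i j h2.ne', neg_zero]
    · rfl

end Pairs

section Rank

open Matrix Finset

variable {n : ℕ}

theorem cardBlock_reducedTaylor_eq_zero (K : Type*) [Field K] {r : ℕ} {A : Fin r → Finset (Fin n)}
    (hmin : ∀ i j, i ≠ j → ¬ A i ⊆ A j) {k : ℕ} (hk : k ≤ 1) (hr : 2 ≤ r) :
    cardBlock (reducedTaylor K A) k = 0 := by
  ext ⟨F, hF⟩ ⟨G, hG⟩
  by_contra h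
  obtain ⟨j, hj, -, hA⟩ := (reducedTaylor_apply_ne_zero_iff A).1 h
  dsimp only at hj hA
  interval_cases k
  · rw [card_eq_zero.1 hF, biUnion_empty] at hA
    have : Nontrivial (Fin r) := Fin.nontrivial_iff_two_le.2 hr
    obtain ⟨i, hi⟩ := exists_ne j
    exact hmin j i hi.symm (hA.trans (empty_subset _))
  · obtain ⟨i, rfl⟩ := card_eq_one.1 hF
    rw [singleton_biUnion] at hA
    exact hmin j i (by simpa using hj) hA

theorem rank_cardBlock_reducedTaylor_eq (K : Type u) (K' : Type v) [Field K] [Field K']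
    {A : Fin 5 → Finset (Fin n)} (hmin : ∀ i j, i ≠ j → ¬ A i ⊆ A j) (k : ℕ) :
    (cardBlock (reducedTaylor K A) k).rank = (cardBlock (reducedTaylor K' A) k).rank := by
  rcases Nat.lt_or_ge 3 k with hk | hk
  · have : Subsingleton {G : Finset (Fin 5) // #G = k + 1} := by
      have huniv : ∀ G : Finset (Fin 5), #G = k + 1 → G = univ := fun G hG =>
        eq_univ_of_card G <| le_antisymm (card_le_univ G) (by rw [hG, Fintype.card_fin]; omega)
      exact ⟨fun G G' => Subtype.ext ((huniv _ G.2).trans (huniv _ G'.2).symm)⟩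
    refine rank_cardBlock_eq_of_ker_mulVecLin_eq ?_
    rw [ker_mulVecLin_cardBlock_of_subsingleton, ker_mulVecLin_cardBlock_of_subsingleton,
      finrank_constrainedFunctions, finrank_constrainedFunctions]
  rcases Nat.lt_or_ge 1 k with hk' | hk'
  · interval_cases k
    · obtain ⟨m, hm⟩ : ∃ m : Finset (Fin n) → Fin 5, ∀ U i, A i ⊆ U → A (m U) ⊆ U := by
        refine ⟨fun U => if h : ∃ i, A i ⊆ U then h.choose else 0, fun U i hi => ?_⟩
        have h : ∃ i, A i ⊆ U := ⟨i, hi⟩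
        simp only [dif_pos h]
        exact h.choose_spec
      refine rank_cardBlock_eq_of_ker_vecMulLinear_eq ?_
      rw [finrank_ker_vecMulLinear_cardBlock_two hm, finrank_ker_vecMulLinear_cardBlock_two hm,
        componentFunctions, componentFunctions, finrank_constrainedFunctions,
        finrank_constrainedFunctions]
    · refine rank_cardBlock_eq_of_ker_mulVecLin_eq ?_
      rw [finrank_ker_mulVecLin_cardBlock K A, finrank_ker_mulVecLin_cardBlock K' A,
        finrank_constrainedFunctions, finrank_constrainedFunctions]
  · rw [cardBlock_reducedTaylor_eq_zero K hmin hk' (by norm_num),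
      cardBlock_reducedTaylor_eq_zero K' hmin hk' (by norm_num), rank_zero, rank_zero]

theorem vecMulExactAt_reducedTaylor_iff (K : Type u) (K' : Type v) [Field K] [Field K']
    {A : Fin 5 → Finset (Fin n)} (hmin : ∀ i j, i ≠ j → ¬ A i ⊆ A j) (k : ℕ) :
    VecMulExactAt (reducedTaylor K A) (k + 1) ↔ VecMulExactAt (reducedTaylor K' A) (k + 1) := by
  rw [vecMulExactAt_succ_iff (reducedTaylor_apply_of_card_ne A) (reducedTaylor_mul_self K A),
    vecMulExactAt_succ_iff (reducedTaylor_apply_of_card_ne A) (reducedTaylor_mul_self K' A),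
    rank_cardBlock_reducedTaylor_eq K K' hmin, rank_cardBlock_reducedTaylor_eq K K' hmin]

end Rank

theorem pdim_field_independent_of_five_generators
    (K : Type u) (K' : Type v) [Field K] [Field K'] (n : ℕ)
    (A : Fin 5 → Finset (Fin n))
    (hmin : ∀ i j : Fin 5, i ≠ j → ¬ A i ⊆ A j) :
    pdim (MvPolynomial (Fin n) K)
        (ModuleCat.of (MvPolynomial (Fin n) K)
          (MvPolynomial (Fin n) K ⧸ sqfIdeal K A))
      = pdim (MvPolynomial (Fin n) K')
        (ModuleCat.of (MvPolynomial (Fin n) K')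
          (MvPolynomial (Fin n) K' ⧸ sqfIdeal K' A)) := by
  refine congrArg sInf (Set.ext fun d => forall_congr' fun k => imp_congr_right fun hk => ?_)
  obtain ⟨k, rfl⟩ : ∃ l, k = l + 1 := Nat.exists_eq_succ_of_ne_zero fun h => by simp [h] at hk
  rw [forall_subsingleton_ext_sqfIdeal_iff, forall_subsingleton_ext_sqfIdeal_iff,
    vecMulExactAt_reducedTaylor_iff K K' hmin]
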